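/- arXiv:1206.6642 — 2 statements merged into one kernel-verified Lean document; each statement's English description precedes it below -/
import Mathlib

section
/- For every nonnegative integer n, p_8(121n + 81) ≡ 0 (mod 121). -/
/-- `multipartition r n` is the number of `r`-component multipartitions of `n`,
i.e. the number of `r`-tuples of integer partitions whose sizes sum to `n`. -/
def multipartition (r n : ℕ) : ℕ :=
  ∑ c ∈ Finset.Nat.antidiagonalTuple r n, ∏ i, Fintype.card (Nat.Partition (c i))

namespace MP8

open PowerSeries PowerSeries.WithPiTopology

/-- sign -/
def ep (k : ℤ) : ℤ := ((Int.negOnePow k : ℤˣ) : ℤ)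

theorem ep_add (a b : ℤ) : ep (a + b) = ep a * ep b := by
  simp [ep, Int.negOnePow_add]
theorem ep_sub (a b : ℤ) : ep (a - b) = ep a * ep b := by
  simp [ep, Int.negOnePow_sub]
theorem ep_neg (a : ℤ) : ep (-a) = ep a := by
  simp [ep]
theorem ep_two (a : ℤ) : ep (2 * a) = 1 := by
  simp [ep]
theorem ep_one : ep 1 = -1 := by
  simp [ep]
theorem ep_mul_self (a : ℤ) : ep a * ep a = 1 := by
  rw [← ep_add, ← two_mul, ep_two]

/-- `F = ∑ a i * X ^ e i` -/
def HS {ι : Type} (a : ι → ℤ) (e : ι → ℕ) (F : ℤ⟦X⟧) : Prop :=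
  HasSum (fun i => monomial (e i) (a i)) F

/-- Euler operator -/
noncomputable def D (f : ℤ⟦X⟧) : ℤ⟦X⟧ := X * PowerSeries.derivative ℤ f

/-- `q ↦ q^2` -/
noncomputable def sg : ℤ⟦X⟧ →ₐ[ℤ] ℤ⟦X⟧ := PowerSeries.expand 2 two_ne_zero

theorem coeff_D (f : ℤ⟦X⟧) (n : ℕ) : coeff n (D f) = n * coeff n f := by
  simp only [D]
  cases n with
  | zero => simp
  | succ n => rw [coeff_succ_X_mul, PowerSeries.coeff_derivative]; push_cast; ring

theorem coeff_sg (f : ℤ⟦X⟧) (n : ℕ) : coeff n (sg f) = if 2 ∣ n then coeff (n / 2) f else 0 :=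
  PowerSeries.coeff_expand ..

theorem sg_X : sg X = X ^ 2 := by simp [sg]
theorem D_X : D X = X := by simp [D]
theorem D_add (f g : ℤ⟦X⟧) : D (f + g) = D f + D g := by simp [D, mul_add]
theorem D_sub (f g : ℤ⟦X⟧) : D (f - g) = D f - D g := by simp [D, mul_sub]
theorem D_mul (f g : ℤ⟦X⟧) : D (f * g) = D f * g + f * D g := by
  simp only [D, Derivation.leibniz, smul_eq_mul]; ring
theorem D_pow (f : ℤ⟦X⟧) (n : ℕ) : D (f ^ (n + 1)) = (n + 1) * f ^ n * D f := by
  simp only [D, Derivation.leibniz_pow, smul_eq_mul, nsmul_eq_mul]; push_cast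
  ring
theorem D_nat (n : ℕ) [n.AtLeastTwo] : D (OfNat.ofNat n : ℤ⟦X⟧) = 0 := by
  have := (PowerSeries.derivative ℤ).map_natCast n
  simp only [D]
  rw [show (OfNat.ofNat n : ℤ⟦X⟧) = ((n : ℕ) : ℤ⟦X⟧) from rfl, this, mul_zero]
theorem D_one : D 1 = 0 := by simp [D]

theorem D_sg (f : ℤ⟦X⟧) : D (sg f) = 2 * sg (D f) := by
  ext n
  rw [show (2 : ℤ⟦X⟧) = C (2 : ℤ) by simp, coeff_C_mul, coeff_D, coeff_sg, coeff_sg, coeff_D]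
  split_ifs with h
  · obtain ⟨m, rfl⟩ := h
    simp; ring
  · simp

namespace HS

variable {ι κ : Type} {a b : ι → ℤ} {e : ι → ℕ} {F G : ℤ⟦X⟧} {c : κ → ℤ} {f : κ → ℕ}

theorem unique (h : HS a e F) (h' : HS a e G) : F = G := HasSum.unique h h'

theorem congr {a' : ι → ℤ} {e' : ι → ℕ} (h : HS a e F) (ha : ∀ i, a i = a' i)
    (he : ∀ i, e i = e' i) : HS a' e' F := by
  rwa [← funext ha, ← funext he]

theorem mul (h : HS a e F) (h' : HS c f G) :
    HS (fun p : ι × κ => a p.1 * c p.2) (fun p => e p.1 + f p.2) (F * G) := by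
  have hN : NonarchimedeanRing ℤ⟦X⟧ := by
    have : IsLinearTopology ℤ⟦X⟧ ℤ⟦X⟧ :=
      inferInstanceAs (IsLinearTopology (MvPowerSeries Unit ℤ) (MvPowerSeries Unit ℤ))
    refine ⟨fun U hU => ?_⟩
    obtain ⟨V, hV, hVU⟩ :=
      (IsLinearTopology.hasBasis_submodule (R := ℤ⟦X⟧) (M := ℤ⟦X⟧)).mem_iff.mp hU
    exact ⟨⟨V.toAddSubgroup, AddSubgroup.isOpen_of_mem_nhds _ hV⟩, hVU⟩
  have := HasSum.mul_of_nonarchimedean h h'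
  simpa [HS, monomial_mul_monomial] using this

theorem add (h : HS a e F) (h' : HS b e G) : HS (fun i => a i + b i) e (F + G) := by
  simpa [HS] using HasSum.add h h'

theorem neg (h : HS a e F) : HS (fun i => - a i) e (-F) := by
  simpa [HS] using HasSum.neg h

theorem sub (h : HS a e F) (h' : HS b e G) : HS (fun i => a i - b i) e (F - G) := by
  simpa [HS] using HasSum.sub h h'

theorem xmul (j : ℕ) (h : HS a e F) : HS a (fun i => j + e i) (X ^ j * F) := by
  have := HasSum.mul_left (X ^ j : ℤ⟦X⟧) h
  simpa [HS, X_pow_eq, monomial_mul_monomial] using this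

theorem cmul (m : ℤ) (h : HS a e F) : HS (fun i => m * a i) e (C m * F) := by
  have := HasSum.mul_left (C m : ℤ⟦X⟧) h
  simpa only [HS, ← monomial_zero_eq_C_apply, monomial_mul_monomial, zero_add] using this

theorem D (h : HS a e F) : HS (fun i => e i * a i) e (MP8.D F) := by
  rw [HS, hasSum_iff_hasSum_coeff] at h ⊢
  intro d
  rw [coeff_D]
  have h2 := (h d).mul_left (d : ℤ)
  have h3 : (fun i => (coeff d) ((monomial (e i)) ((e i : ℤ) * a i))) =
      fun i => (d : ℤ) * (coeff d) ((monomial (e i)) (a i)) := by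
    funext i
    rw [coeff_monomial, coeff_monomial]
    by_cases hh : d = e i
    · rw [if_pos hh, if_pos hh, hh]
    · rw [if_neg hh, if_neg hh, mul_zero]
  rw [h3]
  exact h2

theorem sg (h : HS a e F) : HS a (fun i => 2 * e i) (MP8.sg F) := by
  rw [HS, hasSum_iff_hasSum_coeff] at h ⊢
  intro d
  rw [coeff_sg]
  split_ifs with hd
  · obtain ⟨m, rfl⟩ := hd
    convert h m using 2 with i
    · simp [coeff_monomial]
    · simp
  · convert hasSum_zero using 2 with i
    rw [coeff_monomial, if_neg]
    omega

theorem reindex (g : κ ≃ ι) (h : HS a e F) : HS (fun k => a (g k)) (fun k => e (g k)) F := by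
  have := (Equiv.hasSum_iff g).mpr h
  exact this

theorem dvd (h : HS a e F) (m : ℤ) (n : ℕ) (hm : ∀ i, e i = n → m ∣ a i) : m ∣ coeff n F := by
  rw [HS, hasSum_iff_hasSum_coeff] at h
  have hc : IsClosed {x : ℤ | m ∣ x} := isClosed_discrete _
  refine hc.mem_of_tendsto (h n) (Filter.Eventually.of_forall fun s => ?_)
  refine Finset.dvd_sum fun i _ => ?_
  rw [coeff_monomial]
  split_ifs with hh
  · exact hm i hh.symm
  · simp

theorem split {m : ℕ} (g : Fin m × κ → ι) (hg : Function.Bijective g) (G : Fin m → ℤ⟦X⟧)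
    (h : HS a e F) (h' : ∀ r, HS (fun k => a (g (r, k))) (fun k => e (g (r, k))) (G r)) :
    F = ∑ r, G r := by
  have h1 : HasSum (fun p : Fin m × κ => monomial (e (g p)) (a (g p))) F :=
    (Equiv.hasSum_iff (Equiv.ofBijective g hg)).mpr h
  exact (h1.prod_fiberwise h').unique (hasSum_fintype _)

theorem exists_of (a : ℤ → ℤ) (e : ℤ → ℕ) (he : ∀ k, |k| ≤ e k + 1) : ∃ F, HS a e F := by
  change Summable _
  rw [summable_iff_summable_coeff]
  intro d
  refine summable_of_hasFiniteSupport ((Set.finite_Icc (-(d + 1) : ℤ) (d + 1)).subset ?_)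
  intro k hk
  rw [Function.mem_support, coeff_monomial] at hk
  have : d = e k := by by_contra h; simp [h] at hk
  have h2 := he k
  rw [← this] at h2
  exact abs_le.mp h2

end HS

theorem unit_of {f : ℤ⟦X⟧} (h : constantCoeff f = 1) : IsUnit f := by
  rw [PowerSeries.isUnit_iff_constantCoeff, h]; exact isUnit_one

theorem ne_zero_of {f : ℤ⟦X⟧} (h : constantCoeff f = 1) : f ≠ 0 := by
  rintro rfl; simp at h

/-- fixed points -/
theorem fix1 {f : ℤ⟦X⟧} (h : f = sg f) : f = C (constantCoeff f) := by
  ext n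
  induction n using Nat.strong_induction_on with
  | _ n ih =>
    rcases Nat.eq_zero_or_pos n with rfl | hn
    · simp
    · rw [coeff_C, if_neg hn.ne', h, coeff_sg]
      split_ifs with h2
      · rw [ih (n / 2) (by omega), coeff_C, if_neg (by omega)]
      · rfl

theorem fix4 {f : ℤ⟦X⟧} (h : f = 4 * sg f) : f = 0 := by
  ext n
  induction n using Nat.strong_induction_on with
  | _ n ih =>
    have h1 : coeff n f = 4 * if 2 ∣ n then coeff (n / 2) f else 0 := by
      conv_lhs => rw [h]
      rw [show (4 : ℤ⟦X⟧) = C (4 : ℤ) by simp, coeff_C_mul, coeff_sg]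
    rcases Nat.eq_zero_or_pos n with rfl | hn
    · simp at h1 ⊢; omega
    · rw [h1]
      split_ifs with h2
      · rw [ih (n / 2) (by omega)]; simp
      · simp

theorem fix_neg2 {f : ℤ⟦X⟧} (h : f = -2 * sg f) : f = 0 := by
  ext n
  induction n using Nat.strong_induction_on with
  | _ n ih =>
    have h1 : coeff n f = -2 * if 2 ∣ n then coeff (n / 2) f else 0 := by
      conv_lhs => rw [h]
      rw [show (-2 : ℤ⟦X⟧) = C (-2 : ℤ) by simp, coeff_C_mul, coeff_sg]
    rcases Nat.eq_zero_or_pos n with rfl | hn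
    · simp at h1 ⊢; omega
    · rw [h1]
      split_ifs with h2
      · rw [ih (n / 2) (by omega)]; simp
      · simp

theorem fixX {f : ℤ⟦X⟧} (h : f = -2 * X * sg (sg f)) : f = 0 := by
  ext n
  induction n using Nat.strong_induction_on with
  | _ n ih =>
    rw [h, show (-2 * X * sg (sg f) : ℤ⟦X⟧) = C (-2 : ℤ) * (X * sg (sg f)) by simp; ring,
      coeff_C_mul]
    cases n with
    | zero => simp
    | succ n =>
      rw [coeff_succ_X_mul, coeff_sg]
      split_ifs
      · rw [coeff_sg]
        split_ifs
        · rw [ih _ (by omega)]; simp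
        · simp
      · simp

theorem fix_sq {r : ℤ⟦X⟧} (h0 : constantCoeff r = 1) (h : r ^ 2 = sg r) : r = 1 := by
  obtain ⟨s, rfl⟩ : ∃ s, r = 1 + s := ⟨r - 1, by ring⟩
  have hs0 : coeff 0 s = 0 := by simpa using h0
  have h' : C (2 : ℤ) * s + s * s = sg s := by
    rw [map_add, map_one] at h
    simp only [map_ofNat]
    linear_combination h
  have : s = 0 := by
    ext n
    induction n using Nat.strong_induction_on with
    | _ n ih =>
      rcases Nat.eq_zero_or_pos n with rfl | hn
      · simpa using hs0
      have h1 := congrArg (coeff n) h'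
      rw [map_add, coeff_C_mul, coeff_mul, coeff_sg] at h1
      rw [Finset.sum_eq_zero] at h1
      · have h2 : (if 2 ∣ n then coeff (n / 2) s else 0) = 0 := by
          split_ifs
          · rw [ih _ (by omega)]; simp
          · rfl
        rw [h2] at h1
        simp at h1 ⊢
        exact h1
      · rintro ⟨i, j⟩ hij
        have hij := Finset.HasAntidiagonal.mem_antidiagonal.mp hij
        dsimp only at hij ⊢
        rcases Nat.eq_zero_or_pos j with rfl | hj
        · rw [hs0, mul_zero]
        · rw [ih i (by omega)]; simp
  rw [this, add_zero]


instance instCZ : CharZero ℤ⟦X⟧ :=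
  charZero_of_injective_ringHom (f := (C : ℤ →+* ℤ⟦X⟧)) PowerSeries.C_injective

theorem HS.imul {ι : Type} {a : ι → ℤ} {e : ι → ℕ} {F : ℤ⟦X⟧} (m : ℤ) (h : HS a e F) :
    HS (fun i => m * a i) e ((m : ℤ⟦X⟧) * F) := by
  have := h.cmul m
  rwa [show (C m : ℤ⟦X⟧) = (m : ℤ⟦X⟧) by simp] at this

theorem HS.x1 {ι : Type} {a : ι → ℤ} {e : ι → ℕ} {F : ℤ⟦X⟧} (h : HS a e F) :
    HS a (fun i => 1 + e i) (X * F) := by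
  have := h.xmul 1
  rwa [pow_one] at this

theorem HS.zero_of {ι : Type} {a : ι → ℤ} {e : ι → ℕ} {F : ℤ⟦X⟧} (g : ι ≃ ι) (h : HS a e F)
    (ha : ∀ i, a (g i) = - a i) (he : ∀ i, e (g i) = e i) : F = 0 := by
  have h1 := (h.reindex g).congr ha he
  have h2 := h1.unique h.neg
  have : (2 : ℤ⟦X⟧) * F = 0 := by linear_combination h2
  rcases mul_eq_zero.mp this with h3 | h3
  · exact absurd h3 two_ne_zero
  · exact h3

theorem two_dvd_tt (k : ℤ) : 2 ∣ k * (k + 1) := (Int.even_mul_succ_self k).two_dvd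

theorem two_dvd_gg (k : ℤ) : 2 ∣ 3 * k ^ 2 + k := by
  have h := two_dvd_tt k
  have : 3 * k ^ 2 + k = k * (k + 1) + 2 * k ^ 2 := by ring
  rw [this]
  exact dvd_add h (dvd_mul_right _ _)

def qq (k : ℤ) : ℕ := (k ^ 2).toNat
def tt (k : ℤ) : ℕ := (k * (k + 1) / 2).toNat
def gg (k : ℤ) : ℕ := ((3 * k ^ 2 + k) / 2).toNat
def hh (k : ℤ) : ℕ := (3 * k ^ 2 + 2 * k).toNat

theorem nn_tt (k : ℤ) : 0 ≤ k * (k + 1) := by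
  rcases le_or_gt 0 k with h | h
  · positivity
  · nlinarith

theorem nn_gg (k : ℤ) : 0 ≤ 3 * k ^ 2 + k := by
  have := nn_tt k
  nlinarith [sq_nonneg k]

theorem nn_hh (k : ℤ) : 0 ≤ 3 * k ^ 2 + 2 * k := by
  have := nn_tt k
  nlinarith [sq_nonneg k]

theorem qq_spec (k : ℤ) : (qq k : ℤ) = k ^ 2 := Int.toNat_of_nonneg (sq_nonneg k)

theorem tt_spec (k : ℤ) : 2 * (tt k : ℤ) = k * (k + 1) := by
  have h := nn_tt k
  have h2 := two_dvd_tt k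
  unfold tt
  omega

theorem gg_spec (k : ℤ) : 2 * (gg k : ℤ) = 3 * k ^ 2 + k := by
  have h := nn_gg k
  have h2 := two_dvd_gg k
  unfold gg
  omega

theorem hh_spec (k : ℤ) : (hh k : ℤ) = 3 * k ^ 2 + 2 * k := Int.toNat_of_nonneg (nn_hh k)

theorem bqq (k : ℤ) : |k| ≤ qq k + 1 := by
  rw [qq_spec, abs_le]
  constructor <;> nlinarith [sq_nonneg (k + 1), sq_nonneg (k - 1)]

theorem btt (k : ℤ) : |k| ≤ tt k + 1 := by
  have h := tt_spec k
  rw [abs_le]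
  rcases lt_trichotomy k 0 with h1 | h1 | h1
  · constructor
    · by_cases h3 : k = -1
      · omega
      · have : k + 2 ≤ 0 := by omega
        nlinarith [mul_nonneg (by omega : 0 ≤ -(k + 2)) (by omega : 0 ≤ -(k + 1))]
    · nlinarith
  · constructor <;> omega
  · constructor <;> nlinarith

theorem bgg (k : ℤ) : |k| ≤ gg k + 1 := by
  have h := gg_spec k
  rw [abs_le]
  constructor <;> nlinarith [sq_nonneg (k + 1), sq_nonneg (k - 1)]

theorem bhh (k : ℤ) : |k| ≤ hh k + 1 := by
  have h := hh_spec k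
  rw [abs_le]
  constructor <;> nlinarith [sq_nonneg (k + 1), sq_nonneg (k - 1), nn_tt k, nn_gg k]

noncomputable def ph : ℤ⟦X⟧ := Classical.choose (HS.exists_of (fun _ => 1) qq bqq)
theorem hph : HS (fun _ => 1) qq ph := Classical.choose_spec (HS.exists_of (fun _ => 1) qq bqq)
noncomputable def pm : ℤ⟦X⟧ := Classical.choose (HS.exists_of ep qq bqq)
theorem hpm : HS ep qq pm := Classical.choose_spec (HS.exists_of ep qq bqq)
noncomputable def psi : ℤ⟦X⟧ :=
  Classical.choose (HS.exists_of (fun k => if 0 ≤ k then 1 else 0) tt btt)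
theorem hpsi : HS (fun k => if 0 ≤ k then 1 else 0) tt psi :=
  Classical.choose_spec (HS.exists_of (fun k => if 0 ≤ k then 1 else 0) tt btt)
noncomputable def jj : ℤ⟦X⟧ :=
  Classical.choose (HS.exists_of (fun k => if 0 ≤ k then ep k * (2 * k + 1) else 0) tt btt)
theorem hjj : HS (fun k => if 0 ≤ k then ep k * (2 * k + 1) else 0) tt jj :=
  Classical.choose_spec (HS.exists_of (fun k => if 0 ≤ k then ep k * (2 * k + 1) else 0) tt btt)
noncomputable def dd : ℤ⟦X⟧ := Classical.choose (HS.exists_of (fun k => 6 * k + 1) gg bgg)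
theorem hdd : HS (fun k => 6 * k + 1) gg dd :=
  Classical.choose_spec (HS.exists_of (fun k => 6 * k + 1) gg bgg)
noncomputable def ee : ℤ⟦X⟧ := Classical.choose (HS.exists_of ep gg bgg)
theorem hee : HS ep gg ee := Classical.choose_spec (HS.exists_of ep gg bgg)
noncomputable def cc : ℤ⟦X⟧ := Classical.choose (HS.exists_of (fun k => 3 * k + 1) hh bhh)
theorem hcc : HS (fun k => 3 * k + 1) hh cc :=
  Classical.choose_spec (HS.exists_of (fun k => 3 * k + 1) hh bhh)
noncomputable def cm : ℤ⟦X⟧ :=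
  Classical.choose (HS.exists_of (fun k => ep k * (3 * k + 1)) hh bhh)
theorem hcm : HS (fun k => ep k * (3 * k + 1)) hh cm :=
  Classical.choose_spec (HS.exists_of (fun k => ep k * (3 * k + 1)) hh bhh)

def refl1 : ℤ ≃ ℤ := ⟨fun k => -1 - k, fun k => -1 - k, fun k => by ring, fun k => by ring⟩
def nege : ℤ ≃ ℤ := ⟨fun k => - k, fun k => - k, fun k => by ring, fun k => by ring⟩

theorem tt_refl (k : ℤ) : tt (-1 - k) = tt k := by
  have h1 := tt_spec (-1 - k)
  have h2 := tt_spec k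
  zify
  linarith

theorem ep_refl (k : ℤ) : ep (-1 - k) = - ep k := by
  rw [ep_sub, ep_neg, ep_one]; ring

theorem half_of {a : ℤ → ℤ} {G : ℤ⟦X⟧} (ha : ∀ k, a (-1 - k) = a k)
    (h : HS (fun k => if 0 ≤ k then a k else 0) tt G) : HS a tt (2 * G) := by
  have h1 : HS (fun k => if 0 ≤ (-1 - k) then a k else 0) tt G :=
    (h.reindex refl1).congr (fun k => by simp only [refl1, Equiv.coe_fn_mk, ha]) (fun k => tt_refl k)
  rw [two_mul]
  refine (h.add h1).congr (fun k => ?_) (fun _ => rfl)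
  by_cases hk : 0 ≤ k
  · rw [if_pos hk, if_neg (by omega), add_zero]
  · rw [if_neg hk, if_pos (by omega), zero_add]

theorem hy : HS (fun _ => 1) tt (2 * psi) := half_of (fun _ => rfl) hpsi
theorem hj2 : HS (fun k => ep k * (2 * k + 1)) tt (2 * jj) :=
  half_of (fun k => by rw [ep_refl]; ring) hjj

theorem hz : HS ep tt 0 := by
  obtain ⟨z, hz⟩ := HS.exists_of ep tt btt
  have := hz.zero_of refl1 ep_refl tt_refl
  rwa [this] at hz

theorem const_of {a : ℤ → ℤ} {e : ℤ → ℕ} {F : ℤ⟦X⟧} (h : HS a e F) (h0 : e 0 = 0)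
    (h1 : ∀ k, k ≠ 0 → e k = 0 → a k = 0) : constantCoeff F = a 0 := by
  rw [HS, hasSum_iff_hasSum_coeff] at h
  have h2 := h 0
  have h3 := hasSum_single (f := fun i => (coeff 0) ((monomial (e i)) (a i))) 0 (by
    intro k hk
    rw [coeff_monomial]
    split_ifs with h4
    · exact h1 k hk h4.symm
    · rfl)
  have := h2.unique h3
  rw [coeff_monomial, if_pos h0.symm] at this
  rw [← this, coeff_zero_eq_constantCoeff_apply]

theorem qq0 {k : ℤ} (h : qq k = 0) : k = 0 := by
  have := qq_spec k
  rw [h] at this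
  exact pow_eq_zero_iff (two_ne_zero) |>.mp this.symm
theorem tt0 {k : ℤ} (h : tt k = 0) : k = 0 ∨ k = -1 := by
  have := tt_spec k
  rw [h] at this
  have h2 : k * (k + 1) = 0 := by rw [← this]; simp
  rcases mul_eq_zero.mp h2 with h | h
  · exact Or.inl h
  · right; omega
theorem gg0 {k : ℤ} (h : gg k = 0) : k = 0 := by
  have := gg_spec k
  rw [h] at this
  have h2 : k * (3 * k + 1) = 0 := by simp only [Nat.cast_zero] at this; linear_combination -this
  rcases mul_eq_zero.mp h2 with h | h <;> omega
theorem hh0 {k : ℤ} (h : hh k = 0) : k = 0 := by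
  have := hh_spec k
  rw [h] at this
  have h2 : k * (3 * k + 2) = 0 := by simp only [Nat.cast_zero] at this; linear_combination -this
  rcases mul_eq_zero.mp h2 with h | h <;> omega

theorem ep0 : ep 0 = 1 := by simp [ep]
theorem ph0 : constantCoeff ph = 1 := const_of hph (by decide) fun k hk h => absurd (qq0 h) hk
theorem pm0 : constantCoeff pm = 1 := by
  rw [const_of hpm (by decide) fun k hk h => absurd (qq0 h) hk, ep0]
theorem psi0 : constantCoeff psi = 1 := by
  rw [const_of hpsi (by decide) fun k hk h => ?_]
  · simp
  · rcases tt0 h with h | h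
    · exact absurd h hk
    · subst h; simp
theorem jj0 : constantCoeff jj = 1 := by
  rw [const_of hjj (by decide) fun k hk h => ?_]
  · simp [ep0]
  · rcases tt0 h with h | h
    · exact absurd h hk
    · subst h; simp
theorem dd0 : constantCoeff dd = 1 := by
  rw [const_of hdd (by decide) fun k hk h => absurd (gg0 h) hk]; rfl
theorem ee0 : constantCoeff ee = 1 := by
  rw [const_of hee (by decide) fun k hk h => absurd (gg0 h) hk, ep0]
theorem cc0 : constantCoeff cc = 1 := by
  rw [const_of hcc (by decide) fun k hk h => absurd (hh0 h) hk]; rfl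
theorem cm0 : constantCoeff cm = 1 := by
  rw [const_of hcm (by decide) fun k hk h => absurd (hh0 h) hk, ep0]; rfl
theorem sg0 {f : ℤ⟦X⟧} (h : constantCoeff f = 1) : constantCoeff (sg f) = 1 := by
  rw [← coeff_zero_eq_constantCoeff_apply, coeff_sg]
  simpa using h

/-- parity splitting of the plane -/
def g2 (p : Fin 2 × (ℤ × ℤ)) : ℤ × ℤ :=
  if p.1 = 0 then (p.2.1 + p.2.2, p.2.1 - p.2.2) else (p.2.1 + p.2.2, p.2.1 - p.2.2 - 1)

theorem g2_bij : Function.Bijective g2 := by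
  constructor
  · rintro ⟨r, s, t⟩ ⟨r', s', t'⟩ h
    fin_cases r <;> fin_cases r' <;> simp [g2] at h ⊢ <;> omega
  · rintro ⟨i, j⟩
    rcases Int.even_or_odd' (i + j) with ⟨c, hc | hc⟩
    · refine ⟨(0, (c, i - c)), ?_⟩
      simp [g2]; omega
    · refine ⟨(1, (c + 1, i - c - 1)), ?_⟩
      simp [g2]; omega

theorem split2 {a : ℤ × ℤ → ℤ} {e : ℤ × ℤ → ℕ} {F G H : ℤ⟦X⟧} (h : HS a e F)
    (h0 : HS (fun p : ℤ × ℤ => a (p.1 + p.2, p.1 - p.2)) (fun p => e (p.1 + p.2, p.1 - p.2)) G)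
    (h1 : HS (fun p : ℤ × ℤ => a (p.1 + p.2, p.1 - p.2 - 1))
      (fun p => e (p.1 + p.2, p.1 - p.2 - 1)) H) : F = G + H := by
  rw [h.split g2 g2_bij ![G, H], Fin.sum_univ_two]
  · rfl
  · intro r
    fin_cases r
    · exact h0
    · exact h1

def gz (p : Fin 2 × ℤ) : ℤ := if p.1 = 0 then 2 * p.2 else 2 * p.2 + 1

theorem gz_bij : Function.Bijective gz := by
  constructor
  · rintro ⟨r, s⟩ ⟨r', s'⟩ h
    fin_cases r <;> fin_cases r' <;> simp [gz] at h ⊢ <;> omega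
  · intro i
    rcases Int.even_or_odd' i with ⟨c, hc | hc⟩
    · exact ⟨(0, c), by simp [gz, hc]⟩
    · exact ⟨(1, c), by simp [gz, hc]⟩

theorem splitz {a : ℤ → ℤ} {e : ℤ → ℕ} {F G H : ℤ⟦X⟧} (h : HS a e F)
    (h0 : HS (fun p : ℤ => a (2 * p)) (fun p => e (2 * p)) G)
    (h1 : HS (fun p : ℤ => a (2 * p + 1)) (fun p => e (2 * p + 1)) H) : F = G + H := by
  rw [h.split gz gz_bij ![G, H], Fin.sum_univ_two]
  · rfl
  · intro r
    fin_cases r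
    · exact h0
    · exact h1

theorem ph_pm : ph * pm = sg pm ^ 2 := by
  have h0 : HS (fun p : ℤ × ℤ => 1 * ep (p.1 - p.2))
      (fun p => qq (p.1 + p.2) + qq (p.1 - p.2)) (sg pm * sg pm) := by
    refine (hpm.sg.mul hpm.sg).congr (fun p => ?_) (fun p => ?_)
    · rw [ep_sub, one_mul]
    · zify; simp only [qq_spec]; ring
  have h1 : HS (fun p : ℤ × ℤ => 1 * ep (p.1 - p.2 - 1))
      (fun p => qq (p.1 + p.2) + qq (p.1 - p.2 - 1)) (X * (sg (sg 0) * (((-1 : ℤ) : ℤ⟦X⟧) * sg (sg 0)))) := by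
    refine (((hz.reindex nege).sg.sg).mul (hz.sg.sg.imul (-1))).x1.congr (fun p => ?_) (fun p => ?_)
    · simp [nege, ep_sub, ep_one, ep_neg]
    · have h1 := tt_spec (-p.1)
      have h2 := tt_spec (p.2)
      simp only [nege, Equiv.coe_fn_mk]
      zify; simp only [qq_spec]; linarith
  have := split2 (hph.mul hpm) h0 h1
  rw [this]
  simp; ring

theorem psi_sq : psi ^ 2 = ph * sg psi := by
  have h0 : HS (fun p : ℤ × ℤ => 1 * 1)
      (fun p => tt (p.1 + p.2) + tt (p.1 - p.2)) (sg (2 * psi) * ph) := by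
    refine (hy.sg.mul hph).congr (fun p => ?_) (fun p => ?_)
    · rfl
    · have h1 := tt_spec (p.1 + p.2)
      have h2 := tt_spec (p.1 - p.2)
      have h3 := tt_spec (p.1)
      zify; simp only [qq_spec]; linarith
  have h1 : HS (fun p : ℤ × ℤ => 1 * 1)
      (fun p => tt (p.1 + p.2) + tt (p.1 - p.2 - 1)) (ph * sg (2 * psi)) := by
    refine (hph.mul hy.sg).congr (fun p => ?_) (fun p => ?_)
    · rfl
    · have h1 := tt_spec (p.1 + p.2)
      have h2 := tt_spec (p.1 - p.2 - 1)
      have h3 := tt_spec (p.2)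
      zify; simp only [qq_spec]; linarith
  have := split2 (hy.mul hy) h0 h1
  rw [map_mul, map_ofNat] at this
  have h4 : (4 : ℤ⟦X⟧) * (psi ^ 2) = 4 * (ph * sg psi) := by linear_combination this
  exact mul_left_cancel₀ (by norm_num) h4

theorem ph_split : ph = sg (sg ph) + 2 * X * sg (sg (sg psi)) := by
  have h0 : HS (fun p : ℤ => 1) (fun p => qq (2 * p)) (sg (sg ph)) := by
    refine hph.sg.sg.congr (fun p => rfl) (fun p => ?_)
    zify; simp only [qq_spec]; ring
  have h1 : HS (fun p : ℤ => 1) (fun p => qq (2 * p + 1)) (X * (sg (sg (sg (2 * psi))))) := by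
    refine hy.sg.sg.sg.x1.congr (fun p => rfl) (fun p => ?_)
    have := tt_spec p
    zify; simp only [qq_spec]; linarith
  have := splitz hph h0 h1
  simp only [map_mul, map_ofNat] at this
  linear_combination this

theorem pm_split : pm = sg (sg ph) - 2 * X * sg (sg (sg psi)) := by
  have h0 : HS (fun p : ℤ => ep (2 * p)) (fun p => qq (2 * p)) (sg (sg ph)) := by
    refine hph.sg.sg.congr (fun p => ?_) (fun p => ?_)
    · rw [ep_two]
    zify; simp only [qq_spec]; ring
  have h1 : HS (fun p : ℤ => ep (2 * p + 1)) (fun p => qq (2 * p + 1))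
      (-(X * (sg (sg (sg (2 * psi)))))) := by
    refine hy.sg.sg.sg.x1.neg.congr (fun p => ?_) (fun p => ?_)
    · rw [ep_add, ep_two, ep_one]; ring
    have := tt_spec p
    zify; simp only [qq_spec]; linarith
  have := splitz hpm h0 h1
  simp only [map_mul, map_ofNat] at this
  linear_combination this

theorem jj_sq : jj ^ 2 = ph * (4 * D (sg psi) + sg psi) - 4 * sg psi * D ph := by
  have hY := hy.sg
  have hA : HS (fun k : ℤ => (2 * k + 1) ^ 2) (fun k => 2 * tt k)
      (((4 : ℤ) : ℤ⟦X⟧) * D (sg (2 * psi)) + sg (2 * psi)) := by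
    refine ((hY.D.imul 4).add hY).congr (fun k => ?_) (fun _ => rfl)
    have := tt_spec k
    push_cast
    linear_combination 4 * this
  have hB : HS (fun k : ℤ => 4 * k ^ 2) qq (((4 : ℤ) : ℤ⟦X⟧) * D ph) := by
    refine (hph.D.imul 4).congr (fun k => ?_) (fun _ => rfl)
    rw [qq_spec]; ring
  have h0 : HS (fun p : ℤ × ℤ => (ep (p.1 + p.2) * (2 * (p.1 + p.2) + 1)) *
        (ep (p.1 - p.2) * (2 * (p.1 - p.2) + 1)))
      (fun p => tt (p.1 + p.2) + tt (p.1 - p.2))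
      ((((4 : ℤ) : ℤ⟦X⟧) * D (sg (2 * psi)) + sg (2 * psi)) * ph
        - sg (2 * psi) * (((4 : ℤ) : ℤ⟦X⟧) * D ph)) := by
    have u := hA.mul hph
    have v := hY.mul hB
    have w := u.sub v
    refine w.congr (fun p => ?_) (fun p => ?_)
    · rw [ep_sub, ep_add]
      have h1 := ep_mul_self p.1
      have h2 := ep_mul_self p.2
      linear_combination (-(ep p.2 * ep p.2) * h1 - h2) *
        ((2 * (p.1 + p.2) + 1) * (2 * (p.1 - p.2) + 1))
    · have h1 := tt_spec (p.1 + p.2)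
      have h2 := tt_spec (p.1 - p.2)
      have h3 := tt_spec (p.1)
      zify; simp only [qq_spec]; linarith
  have h1 : HS (fun p : ℤ × ℤ => (ep (p.1 + p.2) * (2 * (p.1 + p.2) + 1)) *
        (ep (p.1 - p.2 - 1) * (2 * (p.1 - p.2 - 1) + 1)))
      (fun p => tt (p.1 + p.2) + tt (p.1 - p.2 - 1))
      (ph * (((4 : ℤ) : ℤ⟦X⟧) * D (sg (2 * psi)) + sg (2 * psi))
        - (((4 : ℤ) : ℤ⟦X⟧) * D ph) * sg (2 * psi)) := by
    have u := hph.mul hA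
    have v := hB.mul hY
    have w := u.sub v
    refine w.congr (fun p => ?_) (fun p => ?_)
    · rw [ep_sub, ep_sub, ep_add, ep_one]
      have h1 := ep_mul_self p.1
      have h2 := ep_mul_self p.2
      linear_combination (-(ep p.2 * ep p.2) * h1 - h2) *
        (-(2 * (p.1 + p.2) + 1) * (2 * (p.1 - p.2 - 1) + 1))
    · have h1 := tt_spec (p.1 + p.2)
      have h2 := tt_spec (p.1 - p.2 - 1)
      have h3 := tt_spec (p.2)
      zify; simp only [qq_spec]; linarith
  have := split2 (hj2.mul hj2) h0 h1
  clear h0 h1 hA hB hY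
  rw [map_mul, map_ofNat, D_mul, D_nat] at this
  push_cast at this
  have h4 : (4 : ℤ⟦X⟧) * (jj ^ 2) =
      4 * (ph * (4 * D (sg psi) + sg psi) - 4 * sg psi * D ph) := by linear_combination this
  exact mul_left_cancel₀ (by norm_num) h4

noncomputable def Ps : ℤ⟦X⟧ := sg psi

theorem Ps0 : constantCoeff Ps = 1 := sg0 psi0
theorem phn : ph ≠ 0 := ne_zero_of ph0
theorem pmn : pm ≠ 0 := ne_zero_of pm0
theorem Psn : Ps ≠ 0 := ne_zero_of Ps0

theorem Ps_sq : Ps ^ 2 = sg ph * sg Ps := by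
  have := congrArg sg psi_sq
  simp only [map_pow, map_mul] at this
  exact this

theorem sum_sq : ph ^ 2 + pm ^ 2 = 2 * sg ph ^ 2 := by
  have h1 := ph_split
  have h2 := pm_split
  have h3 := ph_pm
  have h4 : ph ^ 2 + pm ^ 2 = 4 * sg (sg ph) ^ 2 - 2 * sg pm ^ 2 := by
    have : ph + pm = 2 * sg (sg ph) := by linear_combination h1 + h2
    linear_combination (ph + pm + 2 * sg (sg ph)) * this - 2 * h3
  have : ph ^ 2 + pm ^ 2 - 2 * sg ph ^ 2 = 0 := by
    apply fix_neg2
    simp only [map_sub, map_add, map_mul, map_pow, map_ofNat]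
    linear_combination h4
  linear_combination this

theorem diff_sq : ph ^ 2 - pm ^ 2 = 8 * X * sg Ps ^ 2 := by
  have h1 : ph = sg (sg ph) + 2 * X * sg (sg Ps) := ph_split
  have h2 : pm = sg (sg ph) - 2 * X * sg (sg Ps) := pm_split
  have h3 := congrArg sg Ps_sq
  simp only [map_pow, map_mul] at h3
  rw [h3]
  have e1 : ph + pm = 2 * sg (sg ph) := by linear_combination h1 + h2
  have e2 : ph - pm = 4 * X * sg (sg Ps) := by linear_combination h1 - h2
  linear_combination (ph - pm) * e1 + 2 * sg (sg ph) * e2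

theorem ph_sq : ph ^ 2 = sg ph ^ 2 + 4 * X * sg Ps ^ 2 := by
  have : (2 : ℤ⟦X⟧) * ph ^ 2 = 2 * (sg ph ^ 2 + 4 * X * sg Ps ^ 2) := by
    linear_combination sum_sq + diff_sq
  exact mul_left_cancel₀ two_ne_zero this

theorem pm_sq : pm ^ 2 = sg ph ^ 2 - 4 * X * sg Ps ^ 2 := by
  linear_combination ph_sq - diff_sq

theorem ph4 : ph ^ 4 = pm ^ 4 + 16 * X * Ps ^ 4 := by
  have h1 := ph_sq
  have h2 := pm_sq
  have h3 := Ps_sq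
  have e1 : ph ^ 4 = (sg ph ^ 2 + 4 * X * sg Ps ^ 2) ^ 2 := by rw [← h1]; ring
  have e2 : pm ^ 4 = (sg ph ^ 2 - 4 * X * sg Ps ^ 2) ^ 2 := by rw [← h2]; ring
  have e3 : Ps ^ 4 = (sg ph * sg Ps) ^ 2 := by rw [← h3]; ring
  rw [e1, e2, e3]; ring

theorem cD (f : ℤ⟦X⟧) : constantCoeff (D f) = 0 := by simp [D]

theorem F1 : ph * (4 * D Ps + Ps) - 4 * Ps * D ph = ph * Ps * pm ^ 4 := by
  set N := ph * (4 * D Ps + Ps) - 4 * Ps * D ph with hN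
  have hab := Ps_sq
  have hp := ph_sq
  have hm := pm_sq
  have d1 := congrArg D hab
  have d2 := congrArg D hp
  rw [show Ps ^ 2 = Ps ^ (1 + 1) from rfl, D_pow, D_mul] at d1
  rw [show ph ^ 2 = ph ^ (1 + 1) from rfl, D_pow, D_add, D_mul,
    show sg ph ^ 2 = sg ph ^ (1 + 1) from rfl, D_pow, D_mul,
    show sg Ps ^ 2 = sg Ps ^ (1 + 1) from rfl, D_pow, D_X, D_nat] at d2
  simp only [Nat.cast_one, pow_one] at d1 d2
  have s1 := D_sg ph
  have s2 := D_sg Ps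
  have hsN : sg N = sg ph * (4 * sg (D Ps) + sg Ps) - 4 * sg Ps * sg (D ph) := by
    rw [hN]; simp only [map_sub, map_add, map_mul, map_ofNat]
  have hsN' : sg N = 2 * sg ph * D (sg Ps) + sg ph * sg Ps - 2 * sg Ps * D (sg ph) := by
    rw [hsN, s1, s2]; ring
  have key : N * (ph * Ps) = pm ^ 2 * sg N := by
    rw [hsN', hN, hm]
    have e1 : (ph * (4 * D Ps + Ps) - 4 * Ps * D ph) * (ph * Ps)
      = ph ^ 2 * (2 * ((1 + 1) * Ps * D Ps) + Ps ^ 2) - 2 * Ps ^ 2 * ((1 + 1) * ph * D ph) := by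
      ring
    rw [e1, d1, d2, hab, hp]
    ring
  have c0 : constantCoeff N = 1 := by
    rw [hN]; simp [cD, ph0, Ps0]
  have cU : constantCoeff (ph * Ps * pm ^ 4) = 1 := by simp [ph0, Ps0, pm0]
  obtain ⟨V, hV⟩ : ∃ V, N = (ph * Ps * pm ^ 4) * V := (unit_of cU).dvd
  have hsV : sg N = sg ph * sg Ps * (sg pm ^ 2) ^ 2 * sg V := by
    rw [hV]; simp only [map_mul, map_pow]; ring
  rw [← hab, ← ph_pm] at hsV
  rw [hsV, hV] at key
  have hVV : V = sg V := by
    have hne : ph ^ 2 * Ps ^ 2 * pm ^ 4 ≠ 0 := by simp [phn, Psn, pmn]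
    apply mul_left_cancel₀ hne
    linear_combination key
  have hc := fix1 hVV
  have hV1 : constantCoeff V = 1 := by
    have := congrArg constantCoeff hV
    rw [c0, map_mul, cU, one_mul] at this
    exact this.symm
  rw [hV1, map_one] at hc
  rw [hV, hc, mul_one]

theorem jj_sq' : jj ^ 2 = ph * Ps * pm ^ 4 := by
  rw [← F1]; exact jj_sq

theorem halphen : ∃ L2 L3 L4 : ℤ⟦X⟧, D Ps = Ps * L2 ∧ D ph = ph * L3 ∧ D pm = pm * L4 ∧
    1 + 4 * L2 = 4 * L3 + pm ^ 4 ∧ 4 * L3 = 4 * L4 + 16 * X * Ps ^ 4 ∧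
    D L3 + D L4 = 4 * L3 * L4 := by
  obtain ⟨L2, h2⟩ := (unit_of Ps0).dvd (a := D Ps)
  obtain ⟨L3, h3⟩ := (unit_of ph0).dvd (a := D ph)
  obtain ⟨L4, h4⟩ := (unit_of pm0).dvd (a := D pm)
  have r1 : 1 + 4 * L2 = 4 * L3 + pm ^ 4 := by
    have := F1
    rw [h2, h3] at this
    apply mul_left_cancel₀ (mul_ne_zero phn Psn)
    linear_combination this
  have dm : D (pm ^ 4) = pm ^ 4 * (4 * L4) := by
    rw [show pm ^ 4 = pm ^ (3 + 1) from rfl, D_pow, h4]; push_cast; ring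
  have dp : D (16 * X * Ps ^ 4) = 16 * X * Ps ^ 4 * (1 + 4 * L2) := by
    rw [show Ps ^ 4 = Ps ^ (3 + 1) from rfl, D_mul, D_mul, D_pow, h2, D_X, D_nat]
    push_cast; ring
  have r2 : 4 * L3 = 4 * L4 + 16 * X * Ps ^ 4 := by
    have e := congrArg D ph4
    rw [D_add, dm, dp, show ph ^ 4 = ph ^ (3 + 1) from rfl, D_pow, h3] at e
    push_cast at e
    apply mul_left_cancel₀ (pow_ne_zero 4 pmn)
    have e5 := ph4
    linear_combination e - 4 * L3 * e5 + 16 * X * Ps ^ 4 * r1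
  have r3 : L3 + L4 = 4 * sg L4 := by
    have e := congrArg D ph_pm
    rw [D_mul, h3, h4, show sg pm ^ 2 = sg pm ^ (1 + 1) from rfl, D_pow, D_sg, h4, map_mul] at e
    push_cast at e
    apply mul_left_cancel₀ (mul_ne_zero phn pmn)
    have e5 := ph_pm
    linear_combination e - 4 * sg L4 * e5
  refine ⟨L2, L3, L4, h2, h3, h4, r1, r2, ?_⟩
  have sp : (16 * X * Ps ^ 4) ^ 2 = 16 * sg (16 * X * Ps ^ 4 * ph ^ 4) := by
    simp only [map_mul, map_pow, map_ofNat, sg_X]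
    have : Ps ^ 8 = (sg ph * sg Ps) ^ 4 := by rw [← Ps_sq]; ring
    linear_combination 256 * X ^ 2 * this
  set p := 16 * X * Ps ^ 4 with hp
  set m := pm ^ 4 with hm
  have e4 := ph4
  rw [← hp, ← hm] at e4
  rw [e4] at sp
  -- Z
  have dL : 4 * D L3 = 4 * D L4 + p * (1 + 4 * L2) := by
    have := congrArg D r2
    rw [D_add, D_mul, D_mul, D_nat, dp] at this
    linear_combination this
  have hZ : (4 * D L3 + 4 * D L4 - 16 * L3 * L4) = 0 := by
    apply fix4
    have t1 : D L3 + D L4 = 8 * sg (D L4) := by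
      have := congrArg D r3
      rw [D_add, D_mul, D_nat, D_sg] at this
      linear_combination this
    have t2 : sg (4 * D L3 + 4 * D L4 - 16 * L3 * L4) =
        8 * sg (D L4) + sg (p * (m + p)) - 16 * sg L4 ^ 2 := by
      have : 4 * D L3 + 4 * D L4 - 16 * L3 * L4 = 8 * D L4 + p * (m + p) - 16 * L4 ^ 2 := by
        linear_combination dL + p * r1 + p * r2 - 4 * L4 * r2
      rw [this]
      simp only [map_mul, map_pow, map_sub, map_add, map_ofNat]
    rw [t2]
    have t3 : (4 : ℤ⟦X⟧) * (16 * L3 * L4) = 4 * (16 * (4 * sg L4 ^ 2)) - p ^ 2 := by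
      linear_combination 16 * (L3 + L4 + 4 * sg L4) * r3 - (4 * L3 - 4 * L4 + p) * r2
    apply mul_left_cancel₀ (show (4 : ℤ⟦X⟧) ≠ 0 by norm_num)
    linear_combination 16 * t1 - t3 + sp
  apply mul_left_cancel₀ (show (4 : ℤ⟦X⟧) ≠ 0 by norm_num)
  linear_combination hZ

open Filter in
theorem hasprod_ee : Tendsto (fun n => ∏ i ∈ Finset.range n, (1 - X ^ (i + 1) : ℤ⟦X⟧)) atTop
    (nhds ee) := by
  have h : ee = pentagonalSeries ℤ := by
    have h1 := hasSum_pentagonalSeries ℤ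
    have h2 : HS ep pentagonal (pentagonalSeries ℤ) := by
      have h0 : (fun k : ℤ => ((Int.negOnePow k : ℤˣ) : ℤ⟦X⟧) * X ^ pentagonal k) =
          fun k => monomial (pentagonal k) (ep k) := by
        funext k
        rw [monomial_eq_C_mul_X_pow]
        simp [ep]
      rw [HS, ← h0]
      exact h1
    have h3 := h2.reindex nege
    refine hee.unique (h3.congr (fun k => ep_neg k) (fun k => ?_))
    simp only [nege, Equiv.coe_fn_mk]
    rw [pentagonal_neg, gg]
    congr 2
    ring
  rw [h]
  exact (hasProd_one_sub_X_pow ℤ).tendsto_prod_nat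

theorem tel (u : ℕ → ℤ⟦X⟧) (hu : ∀ i, (1 - X ^ (2 * i + 1)) * u i = 1) (n N : ℕ) (hN : N ≤ n) :
    ∑ s ∈ Finset.range (N + 1), (∏ i ∈ Finset.Ico s n, (1 - X ^ (2 * i + 2)) * u i) *
      X ^ (s * (2 * n + 1)) * ((1 - X ^ (2 * n + 2)) * X ^ (2 * s) - (1 - X ^ (2 * n + 1))) =
    (∏ i ∈ Finset.Ico N n, (1 - X ^ (2 * i + 2)) * u i) * (1 - X ^ (2 * N + 1)) *
      X ^ ((N + 1) * (2 * n + 1)) := by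
  induction N with
  | zero => simp only [zero_add, Finset.sum_range_one]; ring
  | succ N ih =>
    rw [Finset.sum_range_succ, ih (by omega), Finset.prod_eq_prod_Ico_succ_bot (by omega : N < n)]
    have := hu N
    generalize ∏ i ∈ Finset.Ico (N + 1) n, (1 - X ^ (2 * i + 2)) * u i = c
    linear_combination c * (1 - X ^ (2 * N + 2)) * X ^ ((N + 1) * (2 * n + 1)) * this

theorem shanks (u : ℕ → ℤ⟦X⟧) (hu : ∀ i, (1 - X ^ (2 * i + 1)) * u i = 1) (n : ℕ) :
    ∑ s ∈ Finset.range n, (∏ i ∈ Finset.Ico s n, (1 - X ^ (2 * i + 2)) * u i) *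
      X ^ (s * (2 * n + 1)) = ∑ s ∈ Finset.range (2 * n), (X : ℤ⟦X⟧) ^ (tt s) := by
  induction n with
  | zero => simp
  | succ n ih =>
    rw [show 2 * (n + 1) = 2 * n + 1 + 1 by ring, Finset.sum_range_succ (n := 2 * n + 1),
      Finset.sum_range_succ (n := 2 * n), ← ih]
    have t1 : tt ((2 * n : ℕ) : ℤ) = n * (2 * n + 1) := by
      have := tt_spec ((2 * n : ℕ) : ℤ)
      zify; push_cast at this; linarith
    have t2 : tt ((2 * n + 1 : ℕ) : ℤ) = (n + 1) * (2 * n + 1) := by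
      have := tt_spec ((2 * n + 1 : ℕ) : ℤ)
      zify; push_cast at this; linarith
    rw [t1, t2]
    have hne : (1 - X ^ (2 * n + 1) : ℤ⟦X⟧) ≠ 0 := by
      intro h
      have := hu n
      rw [h, zero_mul] at this
      exact zero_ne_one this
    apply mul_left_cancel₀ hne
    have e1 : (1 - X ^ (2 * n + 1) : ℤ⟦X⟧) * ∑ s ∈ Finset.range (n + 1),
        (∏ i ∈ Finset.Ico s (n + 1), (1 - X ^ (2 * i + 2)) * u i) * X ^ (s * (2 * n + 1 + 1 + 1)) =
        ∑ s ∈ Finset.range (n + 1), (∏ i ∈ Finset.Ico s n, (1 - X ^ (2 * i + 2)) * u i) *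
          (1 - X ^ (2 * n + 2)) * X ^ (s * (2 * n + 1) + 2 * s) := by
      rw [Finset.mul_sum]
      refine Finset.sum_congr rfl fun s hs => ?_
      have hs' : s ≤ n := by have := Finset.mem_range.mp hs; omega
      rw [Finset.prod_Ico_succ_top hs']
      have := hu n
      generalize ∏ i ∈ Finset.Ico s n, (1 - X ^ (2 * i + 2)) * u i = c
      rw [show s * (2 * n + 1 + 1 + 1) = s * (2 * n + 1) + 2 * s by ring]
      linear_combination c * (1 - X ^ (2 * n + 2)) * X ^ (s * (2 * n + 1) + 2 * s) * this
    have e2 : (∑ s ∈ Finset.range n, (∏ i ∈ Finset.Ico s n, (1 - X ^ (2 * i + 2)) * u i) *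
        X ^ (s * (2 * n + 1)) + X ^ (n * (2 * n + 1)) : ℤ⟦X⟧) = 
        ∑ s ∈ Finset.range (n + 1), (∏ i ∈ Finset.Ico s n, (1 - X ^ (2 * i + 2)) * u i) *
        X ^ (s * (2 * n + 1)) := by
      rw [Finset.sum_range_succ]; simp
    rw [e1, e2, mul_add]
    have e3 := tel u hu n n le_rfl
    rw [Finset.Ico_self, Finset.prod_empty, one_mul] at e3
    rw [← e3, Finset.mul_sum, ← Finset.sum_add_distrib]
    refine Finset.sum_congr rfl fun s _ => ?_
    ring

open Filter in
theorem tendsto_sg {f : ℕ → ℤ⟦X⟧} {F : ℤ⟦X⟧} (h : Tendsto f atTop (nhds F)) :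
    Tendsto (fun n => sg (f n)) atTop (nhds (sg F)) := by
  rw [tendsto_iff_coeff_tendsto] at h ⊢
  intro d
  simp only [coeff_sg]
  split_ifs
  · exact h (d / 2)
  · exact tendsto_const_nhds

open Filter in
theorem psi_ee : psi * ee = sg ee ^ 2 := by
  have hex : ∀ i : ℕ, ∃ v : ℤ⟦X⟧, (1 - X ^ (2 * i + 1)) * v = 1 := by
    intro i
    obtain ⟨v, hv⟩ := (unit_of (f := (1 - X ^ (2 * i + 1) : ℤ⟦X⟧)) (by simp)).dvd (a := 1)
    exact ⟨v, hv.symm⟩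
  choose u hu using hex
  set Q : ℕ → ℤ⟦X⟧ := fun n => ∏ i ∈ Finset.range n, (1 - X ^ (i + 1) : ℤ⟦X⟧) with hQ
  have hQt : Tendsto Q atTop (nhds ee) := hasprod_ee
  set W : ℕ → ℤ⟦X⟧ := fun n => ∑ s ∈ Finset.range (2 * n), (X : ℤ⟦X⟧) ^ (tt s) with hW
  have hWt : Tendsto W atTop (nhds psi) := by
    have h1 : HasSum (fun k : ℕ => (X : ℤ⟦X⟧) ^ (tt k)) psi := by
      have h0 : (fun k : ℕ => (X : ℤ⟦X⟧) ^ (tt k)) =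
          (fun k : ℤ => monomial (tt k) (if 0 ≤ k then (1 : ℤ) else 0)) ∘ (fun k : ℕ => (k : ℤ)) := by
        funext k
        simp [X_pow_eq]
      rw [h0, Function.Injective.hasSum_iff Nat.cast_injective]
      · exact hpsi
      · intro k hk
        rw [if_neg]
        · simp
        · intro h
          exact hk ⟨k.toNat, by simp [h]⟩
    exact h1.tendsto_sum_nat.comp (tendsto_id.const_mul_atTop' (by norm_num))
  have hc : ∀ n, (∏ i ∈ Finset.Ico 0 n, (1 - X ^ (2 * i + 2)) * u i) * Q (2 * n) = sg (Q n) ^ 2 := by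
    intro n
    rw [Nat.Ico_zero_eq_range]
    induction n with
    | zero => simp [hQ]
    | succ n ih =>
      have e1 : Q (2 * (n + 1)) = Q (2 * n) * (1 - X ^ (2 * n + 1)) * (1 - X ^ (2 * n + 2)) := by
        simp only [hQ]
        rw [show 2 * (n + 1) = 2 * n + 1 + 1 by ring, Finset.prod_range_succ,
          Finset.prod_range_succ]
      have e2 : sg (Q (n + 1)) = sg (Q n) * (1 - X ^ (2 * n + 2)) := by
        simp only [hQ]
        rw [Finset.prod_range_succ, map_mul, map_sub, map_pow, sg_X, map_one, ← pow_mul]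
        ring
      rw [e1, e2, Finset.prod_range_succ]
      linear_combination (1 - X ^ (2 * n + 2)) ^ 2 * ih +
        (∏ i ∈ Finset.range n, (1 - X ^ (2 * i + 2)) * u i) * Q (2 * n) *
          (1 - X ^ (2 * n + 2)) ^ 2 * hu n
  have hd : ∀ n, ∃ R, W n * Q (2 * n) = sg (Q n) ^ 2 + X ^ n * R := by
    intro n
    cases n with
    | zero => exact ⟨W 0 * Q (2 * 0) - sg (Q 0) ^ 2, by ring⟩
    | succ n =>
      have h1 := shanks u hu (n + 1)
      rw [Finset.sum_range_succ', zero_mul, pow_zero, mul_one] at h1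
      have h2 : X ^ (n + 1) ∣ ∑ s ∈ Finset.range n,
          (∏ i ∈ Finset.Ico (s + 1) (n + 1), (1 - X ^ (2 * i + 2)) * u i) *
          X ^ ((s + 1) * (2 * (n + 1) + 1)) := by
        refine Finset.dvd_sum fun s _ => Dvd.dvd.mul_left (pow_dvd_pow _ ?_) _
        nlinarith
      obtain ⟨R, hR⟩ := h2
      rw [hR] at h1
      refine ⟨R * Q (2 * (n + 1)), ?_⟩
      have h3 := hc (n + 1)
      have h4 : W (n + 1) = X ^ (n + 1) * R +
        ∏ i ∈ Finset.Ico 0 (n + 1), (1 - X ^ (2 * i + 2)) * u i := h1.symm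
      rw [h4]
      linear_combination h3
  choose R hR using hd
  have l1 : Tendsto (fun n => W n * Q (2 * n)) atTop (nhds (psi * ee)) :=
    hWt.mul (hQt.comp (tendsto_id.const_mul_atTop' (by norm_num)))
  have l2 : Tendsto (fun n => W n * Q (2 * n)) atTop (nhds (sg ee ^ 2 + 0)) := by
    simp only [hR]
    refine ((tendsto_sg hQt).pow 2).add ?_
    rw [tendsto_iff_coeff_tendsto]
    intro d
    refine tendsto_atTop_of_eventually_const (i₀ := d + 1) fun i hi => ?_
    rw [coeff_X_pow_mul', if_neg (by omega), map_zero]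
  rw [tendsto_nhds_unique l1 l2, add_zero]

theorem fix_sq' {r : ℤ⟦X⟧} (h0 : constantCoeff r = 1) (h : r = sg r ^ 2) : r = 1 := by
  obtain ⟨s, rfl⟩ : ∃ s, r = 1 + s := ⟨r - 1, by ring⟩
  have hs0 : coeff 0 s = 0 := by simpa using h0
  have h' : s = sg (C (2 : ℤ) * s + s * s) := by
    rw [← map_pow] at h
    have h2 : sg ((1 + s) ^ 2) = 1 + sg (C (2 : ℤ) * s + s * s) := by
      rw [← map_one sg, ← map_add]
      congr 1
      simp only [map_ofNat, map_one]
      ring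
    rw [h2] at h
    linear_combination h
  have : s = 0 := by
    ext n
    induction n using Nat.strong_induction_on with
    | _ n ih =>
      rcases Nat.eq_zero_or_pos n with rfl | hn
      · simpa using hs0
      have h1 := congrArg (coeff n) h'
      rw [h1, coeff_sg]
      split_ifs
      · rw [map_add, coeff_C_mul, coeff_mul, ih _ (by omega), Finset.sum_eq_zero]
        · simp
        · rintro ⟨i, j⟩ hij
          have hij := Finset.HasAntidiagonal.mem_antidiagonal.mp hij
          dsimp only at hij ⊢
          rw [ih i (by omega)]; simp
      · simp
  rw [this, add_zero]

theorem een : ee ≠ 0 := ne_zero_of ee0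
theorem e2n : sg ee ≠ 0 := ne_zero_of (sg0 ee0)
theorem e4n : sg (sg ee) ≠ 0 := ne_zero_of (sg0 (sg0 ee0))

theorem Ps_e : Ps * sg ee = sg (sg ee) ^ 2 := by
  have := congrArg sg psi_ee
  rw [map_mul, map_pow] at this
  exact this

theorem ph_e : ph * ee ^ 2 * sg (sg ee) ^ 2 = sg ee ^ 5 := by
  have h1 : psi ^ 2 = ph * Ps := psi_sq
  have h2 := psi_ee
  have h3 := Ps_e
  linear_combination (-ph * ee ^ 2) * h3 - ee ^ 2 * sg ee * h1 +
    sg ee * (psi * ee + sg ee ^ 2) * h2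

theorem pm_e : pm * sg ee = ee ^ 2 := by
  obtain ⟨r, hr⟩ := (unit_of (f := ee ^ 2) (by simp [ee0])).dvd (a := pm * sg ee)
  have c : constantCoeff r = 1 := by
    have := congrArg constantCoeff hr
    simpa [ee0, pm0, sg0 ee0] using this.symm
  have hs := congrArg sg hr
  simp only [map_mul, map_pow] at hs
  have h1 := ph_e
  have h2 := ph_pm
  have : r = sg r ^ 2 := by
    apply mul_left_cancel₀ (mul_ne_zero (pow_ne_zero 2 een) (pow_ne_zero 5 e2n))
    have k1 : ph * pm * ee ^ 2 * sg (sg ee) ^ 2 * sg ee = sg ee ^ 5 * (ee ^ 2 * r) := by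
      rw [← hr]; linear_combination pm * sg ee * h1
    have k2 : sg pm ^ 2 * sg (sg ee) ^ 2 = (sg ee ^ 2 * sg r) ^ 2 := by rw [← hs]; ring
    linear_combination (-1 : ℤ⟦X⟧) * k1 + ee ^ 2 * sg (sg ee) ^ 2 * sg ee * h2 +
      ee ^ 2 * sg ee * k2
  rw [fix_sq' c this, mul_one] at hr
  exact hr

theorem jj_e : jj = ee ^ 3 := by
  have h : jj ^ 2 = (ee ^ 3) ^ 2 := by
    have h1 := ph_e
    have h2 := Ps_e
    have h3 := pm_e
    have h4 := jj_sq'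
    apply mul_left_cancel₀ (mul_ne_zero (mul_ne_zero (pow_ne_zero 2 een) (pow_ne_zero 2 e4n))
      (pow_ne_zero 5 e2n))
    calc ee ^ 2 * sg (sg ee) ^ 2 * sg ee ^ 5 * jj ^ 2
        = (ph * ee ^ 2 * sg (sg ee) ^ 2) * (Ps * sg ee) * (pm * sg ee) ^ 4 := by rw [h4]; ring
      _ = _ := by rw [h1, h2, h3]; ring
  rcases sq_eq_sq_iff_eq_or_eq_neg.mp h with h | h
  · exact h
  · have := congrArg constantCoeff h
    simp [jj0, ee0] at this

theorem B_e : sg ee ^ 3 = ph * pm * Ps := by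
  have h1 := ph_e
  have h2 := Ps_e
  have h3 := pm_e
  apply mul_left_cancel₀ (mul_ne_zero (mul_ne_zero (pow_ne_zero 2 een) (pow_ne_zero 2 e4n))
      (pow_ne_zero 2 e2n))
  calc ee ^ 2 * sg (sg ee) ^ 2 * sg ee ^ 2 * sg ee ^ 3
      = sg ee ^ 5 * sg (sg ee) ^ 2 * ee ^ 2 := by ring
    _ = (ph * ee ^ 2 * sg (sg ee) ^ 2) * (Ps * sg ee) * (pm * sg ee) := by rw [h1, h2, h3]
    _ = _ := by ring

def g3 (p : Fin 3 × (ℤ × ℤ)) : ℤ × ℤ :=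
  if p.1 = 0 then (p.2.1 - 2 * p.2.2, p.2.2 + p.2.1) else
  if p.1 = 1 then (p.2.1 - 1 - 2 * p.2.2, p.2.2 + p.2.1) else
  (p.2.1 + 1 - 2 * p.2.2, p.2.2 + p.2.1)

theorem g3_bij : Function.Bijective g3 := by
  constructor
  · rintro ⟨r, s, t⟩ ⟨r', s', t'⟩ h
    fin_cases r <;> fin_cases r' <;> simp [g3] at h ⊢ <;> omega
  · rintro ⟨i, j⟩
    have h3 : (i + 2 * j) % 3 = 0 ∨ (i + 2 * j) % 3 = 1 ∨ (i + 2 * j) % 3 = 2 := by omega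
    rcases h3 with h | h | h
    · refine ⟨(0, ((i + 2 * j) / 3, j - (i + 2 * j) / 3)), ?_⟩
      simp [g3]; omega
    · refine ⟨(2, ((i + 2 * j) / 3, j - (i + 2 * j) / 3)), ?_⟩
      simp [g3]; omega
    · refine ⟨(1, ((i + 2 * j) / 3 + 1, j - (i + 2 * j) / 3 - 1)), ?_⟩
      simp [g3]; omega

theorem split3 {a : ℤ × ℤ → ℤ} {e : ℤ × ℤ → ℕ} {F G H K : ℤ⟦X⟧} (h : HS a e F)
    (h0 : HS (fun p : ℤ × ℤ => a (p.1 - 2 * p.2, p.2 + p.1))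
      (fun p => e (p.1 - 2 * p.2, p.2 + p.1)) G)
    (h1 : HS (fun p : ℤ × ℤ => a (p.1 - 1 - 2 * p.2, p.2 + p.1))
      (fun p => e (p.1 - 1 - 2 * p.2, p.2 + p.1)) H)
    (h2 : HS (fun p : ℤ × ℤ => a (p.1 + 1 - 2 * p.2, p.2 + p.1))
      (fun p => e (p.1 + 1 - 2 * p.2, p.2 + p.1)) K) : F = G + H + K := by
  rw [h.split g3 g3_bij ![G, H, K], Fin.sum_univ_three]
  · rfl
  · intro r
    fin_cases r
    · exact h0
    · exact h1
    · exact h2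

theorem jj_pm : jj * pm = dd * sg ee := by
  obtain ⟨w, hw⟩ := HS.exists_of (fun k => 4 * k * ep k) qq bqq
  have hA : HS (fun p : ℤ × ℤ => ep p.1 * ep p.2 * (2 * (p.1 + 2 * p.2) + 1))
      (fun p => tt p.1 + qq p.2) (2 * jj * pm + 0 * w) := by
    have u1 := hj2.mul hpm
    have u2 := hz.mul hw
    refine (u1.add u2).congr (fun p => ?_) (fun _ => rfl)
    ring
  have h0 : HS (fun p : ℤ × ℤ => ep (p.1 - 2 * p.2) * ep (p.2 + p.1) *
      (2 * ((p.1 - 2 * p.2) + 2 * (p.2 + p.1)) + 1))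
      (fun p => tt (p.1 - 2 * p.2) + qq (p.2 + p.1)) (dd * sg ee) := by
    have u := hdd.mul (hee.sg.reindex nege)
    refine u.congr (fun p => ?_) (fun p => ?_)
    · have := ep_mul_self p.1
      simp only [nege, Equiv.coe_fn_mk]
      rw [ep_sub, ep_add, ep_two, ep_neg]
      linear_combination (-(6 * p.1 + 1) * ep p.2) * this
    · have a1 := tt_spec (p.1 - 2 * p.2)
      have a2 := gg_spec p.1
      have a3 := gg_spec (-p.2)
      simp only [nege, Equiv.coe_fn_mk]
      zify; simp only [qq_spec]; linarith
  have h1 : HS (fun p : ℤ × ℤ => ep (p.1 - 1 - 2 * p.2) * ep (p.2 + p.1) *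
      (2 * ((p.1 - 1 - 2 * p.2) + 2 * (p.2 + p.1)) + 1))
      (fun p => tt (p.1 - 1 - 2 * p.2) + qq (p.2 + p.1)) (dd * sg ee) := by
    have u := (hdd.reindex nege).mul hee.sg
    refine u.congr (fun p => ?_) (fun p => ?_)
    · have := ep_mul_self p.1
      simp only [nege, Equiv.coe_fn_mk]
      rw [ep_sub, ep_sub, ep_add, ep_two, ep_one]
      linear_combination ((6 * p.1 - 1) * ep p.2) * this
    · have a1 := tt_spec (p.1 - 1 - 2 * p.2)
      have a2 := gg_spec (-p.1)
      have a3 := gg_spec (p.2)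
      simp only [nege, Equiv.coe_fn_mk]
      zify; simp only [qq_spec]; linarith
  obtain ⟨v, hv⟩ := HS.exists_of (fun k => -(6 * k + 3)) (fun k => 3 * tt k) (fun k => by
    have := btt k
    push_cast
    omega)
  obtain ⟨z, hz'⟩ := HS.exists_of ep (fun k => 6 * tt k) (fun k => by
    have := btt k
    push_cast
    omega)
  have hz0 : z = 0 := hz'.zero_of refl1 ep_refl (fun k => by
    change 6 * tt (-1 - k) = 6 * tt k
    rw [tt_refl])
  have h2 : HS (fun p : ℤ × ℤ => ep (p.1 + 1 - 2 * p.2) * ep (p.2 + p.1) *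
      (2 * ((p.1 + 1 - 2 * p.2) + 2 * (p.2 + p.1)) + 1))
      (fun p => tt (p.1 + 1 - 2 * p.2) + qq (p.2 + p.1)) (X * (v * z)) := by
    have u := (hv.mul (hz'.reindex nege)).x1
    refine u.congr (fun p => ?_) (fun p => ?_)
    · have := ep_mul_self p.1
      simp only [nege, Equiv.coe_fn_mk]
      rw [ep_sub, ep_add, ep_add, ep_two, ep_one, ep_neg]
      linear_combination ((6 * p.1 + 3) * ep p.2) * this
    · have a1 := tt_spec (p.1 + 1 - 2 * p.2)
      have a2 := tt_spec (p.1)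
      have a3 := tt_spec (-p.2)
      simp only [nege, Equiv.coe_fn_mk]
      zify; simp only [qq_spec]; linarith
  have := split3 hA h0 h1 h2
  rw [hz0] at this
  apply mul_left_cancel₀ (two_ne_zero (α := ℤ⟦X⟧))
  linear_combination this

theorem dd_e : dd * sg ee ^ 2 = ee ^ 5 := by
  have h1 := jj_pm
  rw [jj_e] at h1
  have h2 := pm_e
  linear_combination (-sg ee) * h1 + ee ^ 3 * h2

theorem cc_split : cc = sg (sg (sg dd)) - 2 * X * sg (sg cc) := by
  have h0 : HS (fun k : ℤ => 3 * (2 * k) + 1) (fun k => hh (2 * k)) (sg (sg (sg dd))) := by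
    refine hdd.sg.sg.sg.congr (fun k => by ring) (fun k => ?_)
    have := gg_spec k
    zify; simp only [hh_spec]; linarith
  have h1 : HS (fun k : ℤ => 3 * (2 * k + 1) + 1) (fun k => hh (2 * k + 1))
      (X * (((-2 : ℤ) : ℤ⟦X⟧) * sg (sg cc))) := by
    refine ((hcc.sg.sg.imul (-2)).reindex refl1).x1.congr (fun k => ?_) (fun k => ?_)
    · simp only [refl1, Equiv.coe_fn_mk]; ring
    · simp only [refl1, Equiv.coe_fn_mk]
      zify; simp only [hh_spec]; ring
  have := splitz hcc h0 h1
  push_cast at this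
  linear_combination this

theorem cm_split : cm = sg (sg (sg dd)) + 2 * X * sg (sg cc) := by
  have h0 : HS (fun k : ℤ => ep (2 * k) * (3 * (2 * k) + 1)) (fun k => hh (2 * k))
      (sg (sg (sg dd))) := by
    refine hdd.sg.sg.sg.congr (fun k => by rw [ep_two]; ring) (fun k => ?_)
    have := gg_spec k
    zify; simp only [hh_spec]; linarith
  have h1 : HS (fun k : ℤ => ep (2 * k + 1) * (3 * (2 * k + 1) + 1)) (fun k => hh (2 * k + 1))
      (X * (((2 : ℤ) : ℤ⟦X⟧) * sg (sg cc))) := by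
    refine ((hcc.sg.sg.imul 2).reindex refl1).x1.congr (fun k => ?_) (fun k => ?_)
    · simp only [refl1, Equiv.coe_fn_mk]; rw [ep_add, ep_two, ep_one]; ring
    · simp only [refl1, Equiv.coe_fn_mk]
      zify; simp only [hh_spec]; ring
  have := splitz hcm h0 h1
  push_cast at this
  linear_combination this

theorem aux_e : sg (sg ph) * sg (sg ee) ^ 2 = sg (sg (sg dd)) := by
  have h1 := congrArg sg (congrArg sg ph_e)
  have h2 := congrArg sg (congrArg sg (congrArg sg dd_e))
  simp only [map_mul, map_pow] at h1 h2
  have h16 : sg (sg (sg (sg ee))) ^ 2 ≠ 0 :=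
    pow_ne_zero 2 (ne_zero_of (sg0 (sg0 (sg0 (sg0 ee0)))))
  apply mul_right_cancel₀ h16
  rw [h1, h2]

theorem aux_e2 : sg (sg (pm * sg (sg ee) ^ 2)) = sg (sg Ps) * sg (sg ee) ^ 2 := by
  have h1 := congrArg sg (congrArg sg pm_e)
  have h2 := congrArg sg (congrArg sg Ps_e)
  simp only [map_mul, map_pow] at h1 h2 ⊢
  have h8 : sg (sg (sg ee)) ≠ 0 := (ne_zero_of (sg0 (sg0 (sg0 ee0))))
  apply mul_right_cancel₀ h8
  linear_combination sg (sg (sg (sg ee))) ^ 2 * h1 - sg (sg ee) ^ 2 * h2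

theorem cc_e : cc = pm * sg (sg ee) ^ 2 := by
  have : cc - pm * sg (sg ee) ^ 2 = 0 := by
    apply fixX
    rw [map_sub, map_sub, aux_e2]
    have h1 : pm = sg (sg ph) - 2 * X * sg (sg Ps) := pm_split
    linear_combination cc_split - sg (sg ee) ^ 2 * h1 - aux_e
  linear_combination this

theorem cm_e : cm = ph * sg (sg ee) ^ 2 := by
  have h1 : ph = sg (sg ph) + 2 * X * sg (sg Ps) := ph_split
  have h2 := cm_split
  rw [cc_e, aux_e2] at h2
  linear_combination h2 - sg (sg ee) ^ 2 * h1 - aux_e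

theorem e10 : HS (fun p : ℤ × ℤ => (3 * p.1 + 1) * (6 * p.2 + 1) *
    (4 * (3 * p.1 + 1) ^ 2 - (6 * p.2 + 1) ^ 2)) (fun p => hh p.1 + 2 * gg p.2)
    (3 * ee ^ 10) := by
  have hd := hdd.sg
  have hU : HS (fun k : ℤ => (3 * k + 1) ^ 3) hh (((3 : ℤ) : ℤ⟦X⟧) * D cc + cc) := by
    refine ((hcc.D.imul 3).add hcc).congr (fun k => ?_) (fun _ => rfl)
    rw [hh_spec]; ring
  have hY : HS (fun k : ℤ => (6 * k + 1) ^ 3) (fun k => 2 * gg k)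
      (((12 : ℤ) : ℤ⟦X⟧) * D (sg dd) + sg dd) := by
    refine ((hd.D.imul 12).add hd).congr (fun k => ?_) (fun _ => rfl)
    have := gg_spec k
    push_cast
    linear_combination 12 * (6 * k + 1) * this
  have u := (hU.mul hd).imul 4
  have v := hcc.mul hY
  have w := u.sub v
  have e : ((4 : ℤ) : ℤ⟦X⟧) * ((((3 : ℤ) : ℤ⟦X⟧) * D cc + cc) * sg dd) -
      cc * (((12 : ℤ) : ℤ⟦X⟧) * D (sg dd) + sg dd) = 3 * ee ^ 10 := by
    have h1 : cc = (pm * sg ee) * Ps := by rw [cc_e, ← Ps_e]; ring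
    have h2 : sg dd = (pm * sg ee) * ph := by
      have t1 := congrArg sg dd_e
      simp only [map_mul, map_pow] at t1
      apply mul_right_cancel₀ (pow_ne_zero 2 e4n)
      rw [t1, pm_e, ← ph_e]; ring
    have h3 := jj_sq'
    rw [jj_e, ← F1] at h3
    rw [h1, h2, pm_e, D_mul, D_mul (ee ^ 2) ph]
    push_cast
    linear_combination (-3 * ee ^ 4) * h3
  rw [e] at w
  refine w.congr (fun p => ?_) (fun p => rfl)
  ring

theorem e14 : HS (fun p : ℤ × ℤ => (3 * p.1 + 1) * (2 * p.2 + 1) * (ep p.1 * ep p.2 *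
    (16 * (3 * p.1 + 1) ^ 4 - 40 * (3 * p.1 + 1) ^ 2 * (2 * p.2 + 1) ^ 2
      + 9 * (2 * p.2 + 1) ^ 4))) (fun p => hh p.1 + 2 * tt p.2)
    (-30 * ee ^ 14) := by
  obtain ⟨L2, L3, L4, d2, d3, d4, r1, r2, r3⟩ := halphen
  have hB := hj2.sg
  have hU : ∀ {a : ℤ → ℤ} {F : ℤ⟦X⟧}, HS a hh F →
      HS (fun k : ℤ => (3 * k + 1) ^ 2 * a k) hh (((3 : ℤ) : ℤ⟦X⟧) * D F + F) := by
    intro a F h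
    refine ((h.D.imul 3).add h).congr (fun k => ?_) (fun _ => rfl)
    rw [hh_spec]; ring
  have hY : ∀ {a : ℤ → ℤ} {F : ℤ⟦X⟧}, HS a (fun k => 2 * tt k) F →
      HS (fun k : ℤ => (2 * k + 1) ^ 2 * a k) (fun k => 2 * tt k)
        (((4 : ℤ) : ℤ⟦X⟧) * D F + F) := by
    intro a F h
    refine ((h.D.imul 4).add h).congr (fun k => ?_) (fun _ => rfl)
    have := tt_spec k
    push_cast
    linear_combination 4 * a k * this
  have hBe : sg (2 * jj) = 2 * (ph * pm * Ps) := by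
    rw [map_mul, map_ofNat, jj_e, map_pow, B_e]
  -- log derivatives
  have c3 : cm ^ 3 = ph ^ 4 * Ps ^ 4 * pm := by
    have : cm = ph * Ps * sg ee := by rw [cm_e, ← Ps_e]; ring
    rw [this]
    linear_combination ph ^ 3 * Ps ^ 3 * B_e
  have dc : 3 * D cm = cm * (4 * L2 + 4 * L3 + L4) := by
    have := congrArg D c3
    rw [show cm ^ 3 = cm ^ (2 + 1) from rfl, show ph ^ 4 = ph ^ (3 + 1) from rfl,
      show Ps ^ 4 = Ps ^ (3 + 1) from rfl, D_mul, D_mul, D_pow, D_pow, D_pow, d2, d3, d4] at this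
    push_cast at this
    apply mul_left_cancel₀ (pow_ne_zero 2 (ne_zero_of cm0))
    linear_combination this - (4 * L2 + 4 * L3 + L4) * c3
  set γ := 1 + 4 * L2 + 4 * L3 + L4 with hγ
  set β := 1 + 4 * L2 + 4 * L3 + 4 * L4 with hβ
  have hUc : ((3 : ℤ) : ℤ⟦X⟧) * D cm + cm = cm * γ := by
    push_cast; linear_combination dc
  have hUUc : ((3 : ℤ) : ℤ⟦X⟧) * D (cm * γ) + cm * γ = cm * (γ ^ 2 + 3 * D γ) := by
    rw [D_mul]
    push_cast; linear_combination γ * dc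
  have hYB : ((4 : ℤ) : ℤ⟦X⟧) * D (2 * (ph * pm * Ps)) + 2 * (ph * pm * Ps) =
      2 * (ph * pm * Ps) * β := by
    rw [D_mul, D_mul, D_mul, d2, d3, d4, D_nat]
    push_cast; ring
  have hYYB : ((4 : ℤ) : ℤ⟦X⟧) * D (2 * (ph * pm * Ps) * β) + 2 * (ph * pm * Ps) * β =
      2 * (ph * pm * Ps) * (β ^ 2 + 4 * D β) := by
    rw [D_mul]
    push_cast at hYB ⊢; linear_combination β * hYB
  rw [hBe] at hB
  have u1 := hU hcm
  rw [hUc] at u1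
  have u2 := hU u1
  rw [hUUc] at u2
  have v1 := hY hB
  rw [hYB] at v1
  have v2 := hY v1
  rw [hYYB] at v2
  have w1 := (u2.mul hB).imul 16
  have w2 := (u1.mul v1).imul 40
  have w3 := (hcm.mul v2).imul 9
  have w4 := w1.sub w2
  have w := w4.add w3
  have Dγ : D γ = 4 * D L2 + 4 * D L3 + D L4 := by
    rw [hγ, D_add, D_add, D_add, D_mul, D_mul, D_one, D_nat]; ring
  have Dβ : D β = 4 * D L2 + 4 * D L3 + 4 * D L4 := by
    rw [hβ, D_add, D_add, D_add, D_mul, D_mul, D_mul, D_one, D_nat]; ring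
  have dm : 4 * D L2 = 4 * D L3 + pm ^ 4 * (4 * L4) := by
    have := congrArg D r1
    rw [show pm ^ 4 = pm ^ (3 + 1) from rfl, D_add, D_add, D_mul, D_mul, D_pow, d4, D_one, D_nat] at this
    push_cast at this
    linear_combination this
  have dp : 4 * D L3 = 4 * D L4 + 16 * X * Ps ^ 4 * (1 + 4 * L2) := by
    have := congrArg D r2
    rw [show Ps ^ 4 = Ps ^ (3 + 1) from rfl, D_add, D_mul, D_mul, D_mul, D_mul, D_pow, d2, D_nat,
      D_nat, D_X] at this
    push_cast at this
    linear_combination this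
  have key : 16 * (γ ^ 2 + 3 * D γ) - 40 * γ * β + 9 * (β ^ 2 + 4 * D β) = -15 * (pm ^ 4) ^ 2 := by
    rw [Dγ, Dβ]
    have hp : 16 * X * Ps ^ 4 = 4 * L3 - 4 * L4 := by linear_combination -r2
    have hm : pm ^ 4 = 1 + 4 * L2 - 4 * L3 := by linear_combination -r1
    rw [hp] at dp
    rw [hm] at dm ⊢
    rw [hγ, hβ]
    linear_combination 84 * dm + 60 * dp + 432 * r3
  have fin : cm * (ph * pm * Ps) * (pm ^ 4) ^ 2 = ee ^ 14 := by
    rw [← B_e, cm_e]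
    apply mul_left_cancel₀ (mul_ne_zero (pow_ne_zero 2 een) (pow_ne_zero 8 e2n))
    calc ee ^ 2 * sg ee ^ 8 * (ph * sg (sg ee) ^ 2 * sg ee ^ 3 * (pm ^ 4) ^ 2)
        = (ph * ee ^ 2 * sg (sg ee) ^ 2) * sg ee ^ 3 * (pm * sg ee) ^ 8 := by ring
      _ = _ := by rw [ph_e, pm_e]; ring
  have e : ((16 : ℤ) : ℤ⟦X⟧) * (cm * (γ ^ 2 + 3 * D γ) * (2 * (ph * pm * Ps))) -
      ((40 : ℤ) : ℤ⟦X⟧) * (cm * γ * (2 * (ph * pm * Ps) * β)) +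
      ((9 : ℤ) : ℤ⟦X⟧) * (cm * (2 * (ph * pm * Ps) * (β ^ 2 + 4 * D β))) = -30 * ee ^ 14 := by
    push_cast
    linear_combination 2 * cm * (ph * pm * Ps) * key - 30 * fin
  rw [e] at w
  refine w.congr (fun p => ?_) (fun p => rfl)
  ring

theorem mod1 (u y : ℤ) (h : (11 : ℤ) ∣ 4 * u ^ 2 + y ^ 2) : (11 : ℤ) ∣ u ∧ (11 : ℤ) ∣ y := by
  have key : ∀ a b : ZMod 11, 4 * a ^ 2 + b ^ 2 = 0 → a = 0 ∧ b = 0 := by decide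
  have h1 := (ZMod.intCast_zmod_eq_zero_iff_dvd _ 11).mpr h
  push_cast at h1
  have := key _ _ h1
  exact ⟨(ZMod.intCast_zmod_eq_zero_iff_dvd _ 11).mp this.1,
    (ZMod.intCast_zmod_eq_zero_iff_dvd _ 11).mp this.2⟩

theorem mod2 (u y : ℤ) (h : (11 : ℤ) ∣ 4 * u ^ 2 + 3 * y ^ 2) : (11 : ℤ) ∣ u ∧ (11 : ℤ) ∣ y := by
  have key : ∀ a b : ZMod 11, 4 * a ^ 2 + 3 * b ^ 2 = 0 → a = 0 ∧ b = 0 := by decide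
  have h1 := (ZMod.intCast_zmod_eq_zero_iff_dvd _ 11).mpr h
  push_cast at h1
  have := key _ _ h1
  exact ⟨(ZMod.intCast_zmod_eq_zero_iff_dvd _ 11).mp this.1,
    (ZMod.intCast_zmod_eq_zero_iff_dvd _ 11).mp this.2⟩

theorem ten_dvd (m : ℕ) : (11 : ℤ) ∣ coeff (11 * m + 6) (ee ^ 10) := by
  have h := e10.dvd 11 (11 * m + 6) (fun p hp => by
    have h1 := hh_spec p.1
    have h2 := gg_spec p.2
    have h3 : (hh p.1 : ℤ) + 2 * gg p.2 = 11 * m + 6 := by exact_mod_cast hp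
    have := mod1 (3 * p.1 + 1) (6 * p.2 + 1) ⟨12 * m + 7, by
      linear_combination 12 * h3 - 12 * h1 - 12 * h2⟩
    exact Dvd.dvd.mul_right (Dvd.dvd.mul_right this.1 _) _)
  rw [show (3 : ℤ⟦X⟧) = C (3 : ℤ) by simp, coeff_C_mul] at h
  omega

theorem fourteen_dvd (m : ℕ) : (121 : ℤ) ∣ coeff (11 * m + 4) (ee ^ 14) := by
  have h := e14.dvd 121 (11 * m + 4) (fun p hp => by
    have h1 := hh_spec p.1
    have h2 := tt_spec p.2
    have h3 : (hh p.1 : ℤ) + 2 * tt p.2 = 11 * m + 4 := by exact_mod_cast hp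
    have := mod2 (3 * p.1 + 1) (2 * p.2 + 1) ⟨12 * m + 5, by
      linear_combination 12 * h3 - 12 * h1 - 12 * h2⟩
    refine Dvd.dvd.mul_right ?_ _
    rw [show (121 : ℤ) = 11 * 11 by norm_num]
    exact mul_dvd_mul this.1 this.2)
  rw [show (-30 : ℤ⟦X⟧) = C (-30 : ℤ) by simp, coeff_C_mul] at h
  omega

theorem eleven_dvd (k : ℤ) (m : ℤ) (h : 2 * (11 * m + 4) = k * (k + 1)) : (11 : ℤ) ∣ 2 * k + 1 := by
  have hp : Prime (11 : ℤ) := by norm_num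
  apply hp.dvd_of_dvd_pow (n := 2)
  exact ⟨8 * m + 3, by linear_combination -4 * h⟩

theorem three_dvd (m : ℕ) : (11 : ℤ) ∣ coeff (11 * m + 4) (ee ^ 3) := by
  rw [← jj_e]
  refine hjj.dvd 11 _ (fun k hk => ?_)
  have h := tt_spec k
  rw [hk] at h
  push_cast at h
  split_ifs
  · exact Dvd.dvd.mul_left (eleven_dvd k m h) _
  · simp

theorem three_zero (m : ℕ) (hm : m % 11 ≠ 1) : coeff (11 * m + 4) (ee ^ 3) = 0 := by
  rw [← jj_e]
  refine zero_dvd_iff.mp (hjj.dvd 0 _ (fun k hk => ?_))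
  exfalso
  have h := tt_spec k
  rw [hk] at h
  push_cast at h
  obtain ⟨c, hc⟩ := eleven_dvd k m h
  have : 8 * (11 * (m : ℤ) + 4) + 1 = 121 * c ^ 2 := by
    have : (2 * k + 1) ^ 2 = 121 * c ^ 2 := by rw [hc]; ring
    linear_combination this + 4 * h
  omega

theorem frob (f : ℤ⟦X⟧) (n : ℕ) :
    (11 : ℤ) ∣ coeff n (f ^ 11 - expand 11 (by norm_num) f) := by
  have : Fact (Nat.Prime 11) := ⟨by norm_num⟩
  set t : Polynomial ℤ := trunc (n + 1) f with ht
  have h1 : coeff n (f ^ 11) = (t ^ 11).coeff n := by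
    have h := trunc_trunc_pow f (n + 1) 11
    have h2 := congrArg (fun p => Polynomial.coeff p n) h
    simp only [coeff_trunc, Nat.lt_succ_self, if_true] at h2
    rw [← h2, ← Polynomial.coe_pow, Polynomial.coeff_coe]
  have h2 : coeff n (expand 11 (by norm_num) f) = (Polynomial.expand ℤ 11 t).coeff n := by
    rw [Polynomial.coeff_expand (by norm_num), coeff_expand]
    split_ifs with h
    · rw [ht, coeff_trunc, if_pos (Nat.lt_succ_of_le (Nat.div_le_self _ _))]
    · rfl
  rw [map_sub, h1, h2, ← Polynomial.coeff_sub]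
  refine (ZMod.intCast_zmod_eq_zero_iff_dvd _ 11).1 ?_
  have h3 : Polynomial.map (Int.castRingHom (ZMod 11)) (t ^ 11 - Polynomial.expand ℤ 11 t) = 0 := by
    rw [Polynomial.map_sub, Polynomial.map_pow, Polynomial.map_expand, ZMod.expand_card, sub_self]
  have h4 := congrArg (fun p => Polynomial.coeff p n) h3
  simpa only [Polynomial.coeff_map, Polynomial.coeff_zero, eq_intCast] using h4

theorem frob' (f : ℤ⟦X⟧) : ∃ G : ℤ⟦X⟧, f ^ 11 = expand 11 (by norm_num) f + 11 * G := by
  choose g hg using frob f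
  refine ⟨PowerSeries.mk g, ?_⟩
  ext n
  have h := hg n
  have e : (11 : ℤ⟦X⟧) = C (11 : ℤ) := by simp
  rw [map_sub] at h
  rw [map_add, e, coeff_C_mul, coeff_mk, ← h]
  ring

noncomputable def PP : ℤ⟦X⟧ := PowerSeries.mk (fun n => (Fintype.card (Nat.Partition n) : ℤ))

open Filter in
theorem PP_ee : PP * ee = 1 := by
  have h1 := Nat.Partition.hasProd_powerSeriesMk_card_restricted ℤ (fun _ => True)
  have h2 : (PowerSeries.mk fun n ↦ (((Nat.Partition.restricted n (fun _ => True)).card : ℕ) : ℤ)) = PP := by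
    unfold PP
    congr 1
    funext n
    simp [Nat.Partition.restricted, Finset.card_univ]
  rw [h2] at h1
  have h3 := h1.tendsto_prod_nat.mul hasprod_ee
  refine tendsto_nhds_unique h3 ?_
  refine tendsto_const_nhds.congr (fun n => ?_)
  rw [← Finset.prod_mul_distrib]
  symm
  refine Finset.prod_eq_one (fun i _ => ?_)
  simp only [if_true, pow_mul]
  exact tsum_pow_mul_one_sub_of_constantCoeff_eq_zero (by simp)

theorem multi_eq (r n : ℕ) :
    ((∑ c ∈ Finset.Nat.antidiagonalTuple r n, ∏ i, Fintype.card (Nat.Partition (c i)) : ℕ) : ℤ)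
      = coeff n (PP ^ r) := by
  have h : PP ^ r = ∏ _i : Fin r, PP := by simp
  rw [h, coeff_prod, ← Finset.piAntidiag_univ_fin_eq_antidiagonalTuple]
  push_cast
  refine Finset.sum_bij' (fun c _ => Finsupp.equivFunOnFinite.symm c) (fun l _ => (l : Fin r → ℕ))
    ?_ ?_ ?_ ?_ ?_
  · intro c hc
    simpa [Finset.mem_finsuppAntidiag] using hc
  · intro c hc
    simpa [Finset.mem_finsuppAntidiag] using hc
  · intro c hc
    rfl
  · intro c hc
    ext i
    rfl
  · intro c hc
    simp [PP]

theorem PP_dvd (m : ℕ) : (11 : ℤ) ∣ coeff (11 * m + 6) PP := by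
  obtain ⟨G, hG⟩ := frob' ee
  have hX : expand 11 (by norm_num) PP * expand 11 (by norm_num) ee = 1 := by
    rw [← map_mul, PP_ee, map_one]
  have e : (11 : ℤ⟦X⟧) = C (11 : ℤ) := by simp
  have key : PP = ee ^ 10 * expand 11 (by norm_num) PP
      - 11 * (G * PP * expand 11 (by norm_num) PP) := by
    linear_combination (-PP) * hX - (PP * expand 11 (by norm_num) PP) * hG
      + (ee ^ 10 * expand 11 (by norm_num) PP) * PP_ee
  rw [key, map_sub, e, coeff_C_mul]
  refine dvd_sub ?_ (Dvd.intro _ rfl)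
  rw [coeff_mul]
  refine Finset.dvd_sum (fun x hx => ?_)
  rw [Finset.HasAntidiagonal.mem_antidiagonal] at hx
  rw [coeff_expand]
  split_ifs with h
  · obtain ⟨k, hk⟩ := h
    have : x.1 = 11 * (m - k) + 6 := by omega
    rw [this]
    exact Dvd.dvd.mul_right (ten_dvd _) _
  · simp

theorem main (n : ℕ) : (121 : ℤ) ∣ coeff (121 * n + 81) (PP ^ 8) := by
  obtain ⟨G, hG⟩ := frob' ee
  have hX : expand 11 (by norm_num) PP * expand 11 (by norm_num) ee = 1 := by
    rw [← map_mul, PP_ee, map_one]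
  have e : (121 : ℤ⟦X⟧) = C (121 : ℤ) := by simp
  have e2 : (2 : ℤ⟦X⟧) = C (2 : ℤ) := by simp
  have hp : PP ^ 8 * ee ^ 8 = 1 := by rw [← mul_pow, PP_ee, one_pow]
  have key : PP ^ 8 = 2 * (ee ^ 3 * expand 11 (by norm_num) PP)
      - ee ^ 14 * expand 11 (by norm_num) (PP ^ 2)
      + 121 * (G ^ 2 * PP ^ 8 * expand 11 (by norm_num) PP ^ 2) := by
    rw [map_pow]
    generalize expand 11 (by norm_num) PP = p at *
    generalize expand 11 (by norm_num) ee = x at *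
    have h2 : ee ^ 22 - 2 * x * ee ^ 11 + x ^ 2 = 121 * G ^ 2 := by
      rw [show ee ^ 22 = (ee ^ 11) ^ 2 by ring, hG]; ring
    have h3 : ee ^ 14 - 2 * x * ee ^ 3 + x ^ 2 * PP ^ 8 = 121 * G ^ 2 * PP ^ 8 := by
      linear_combination PP ^ 8 * h2 - (ee ^ 14 - 2 * x * ee ^ 3) * hp
    linear_combination p ^ 2 * h3 + (2 * ee ^ 3 * p - PP ^ 8 * (p * x + 1)) * hX
  rw [key, map_add, map_sub, e, e2, coeff_C_mul, coeff_C_mul]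
  refine dvd_add (dvd_sub (Dvd.dvd.mul_left ?_ _) ?_) (Dvd.intro _ rfl)
  · rw [coeff_mul]
    refine Finset.dvd_sum (fun x hx => ?_)
    rw [Finset.HasAntidiagonal.mem_antidiagonal] at hx
    rw [coeff_expand]
    split_ifs with h
    · obtain ⟨k, hk⟩ := h
      have h1 : x.1 = 11 * (11 * n + 7 - k) + 4 := by omega
      by_cases hm : (11 * n + 7 - k) % 11 = 1
      · have h2 : x.2 / 11 = 11 * (k / 11) + 6 := by omega
        rw [h1, h2]
        exact mul_dvd_mul (three_dvd _) (PP_dvd _)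
      · rw [h1, three_zero _ hm]
        simp
    · simp
  · rw [coeff_mul]
    refine Finset.dvd_sum (fun x hx => ?_)
    rw [Finset.HasAntidiagonal.mem_antidiagonal] at hx
    rw [coeff_expand]
    split_ifs with h
    · obtain ⟨k, hk⟩ := h
      have h1 : x.1 = 11 * (11 * n + 7 - k) + 4 := by omega
      rw [h1]
      exact Dvd.dvd.mul_right (fourteen_dvd _) _
    · simp

end MP8

theorem multipartition_eight_onetwentyone (n : ℕ) : 121 ∣ multipartition 8 (121 * n + 81) := by
  have h := MP8.main n
  rw [← MP8.multi_eq] at h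
  exact_mod_cast h
end

section
/- For every nonnegative integer n, p_3(11n + 7) ≡ 0 (mod 11). -/
open PowerSeries PowerSeries.WithPiTopology Filter Topology

namespace MP

abbrev K := ZMod 11
abbrev A := PowerSeries K

instance : Fact (Nat.Prime 11) := ⟨by norm_num⟩

lemma hs_congr {ι : Type} {f g : ι → A} {a c : A} (h : HasSum f a) (hf : ∀ x, g x = f x)
    (hac : c = a) : HasSum g c := by
  rw [hac, show g = f from funext hf]; exact h

noncomputable def E : A := pentagonalSeries K

noncomputable def P (m : ℕ) : A := ∏ t ∈ Finset.range m, (1 - X ^ (t + 1))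

lemma P_succ (m : ℕ) : P (m + 1) = P m * (1 - X ^ (m + 1)) := by
  simp [P, Finset.prod_range_succ]

lemma P_zero : P 0 = 1 := by simp [P]

lemma P_dvd (m d : ℕ) : (X : A) ^ (m + 1) ∣ P (m + d) - P m := by
  induction d with
  | zero => simp
  | succ d ih =>
    rw [← add_assoc, P_succ]
    have : P (m + d) * (1 - X ^ (m + d + 1)) - P m
        = (P (m + d) - P m) - X ^ (m + 1) * (X ^ d * P (m + d)) := by ring
    rw [this]
    exact dvd_sub ih (Dvd.intro _ rfl)

lemma E_dvd (m : ℕ) : (X : A) ^ (m + 1) ∣ E - P m := by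
  rw [X_pow_dvd_iff]
  intro n hn
  have h := coeff_prod_one_sub_X_pow_eventually_eq K n
  have h2 := (tendsto_finset_range.eventually h).and (eventually_ge_atTop m)
  obtain ⟨M, hM, hm⟩ := h2.exists
  obtain ⟨d, rfl⟩ := Nat.exists_eq_add_of_le hm
  have h3 := (X_pow_dvd_iff.1 (P_dvd m d)) n hn
  rw [map_sub] at h3 ⊢
  rw [E, ← hM]
  exact h3

lemma E_dvd' {m N : ℕ} (h : N ≤ m) : (X : A) ^ (N + 1) ∣ E - P m :=
  (pow_dvd_pow _ (by omega)).trans (E_dvd m)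

lemma P_const (m : ℕ) : constantCoeff (P m) = 1 := by
  simp [P, map_prod]

lemma P_unit (m : ℕ) : IsUnit (P m) := by
  rw [isUnit_iff_constantCoeff, P_const]; exact isUnit_one

lemma E_unit : IsUnit E := by
  rw [isUnit_iff_constantCoeff]
  have h := X_pow_dvd_iff.1 (E_dvd 0) 0 (by omega)
  rw [map_sub, sub_eq_zero, P_zero] at h
  simp only [coeff_zero_eq_constantCoeff] at h
  rw [h]; simp

noncomputable def p : A := PowerSeries.mk fun n ↦ (Fintype.card (Nat.Partition n) : K)

lemma p_mul_E : p * E = 1 := by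
  have h1 := Nat.Partition.hasProd_powerSeriesMk_card_restricted K (fun _ => True)
  have h2 := h1.mul (hasProd_one_sub_X_pow K)
  have h3 : (PowerSeries.mk fun n ↦ ((Nat.Partition.restricted n (fun _ => True)).card : K)) = p := by
    simp [p, Nat.Partition.restricted]
  rw [h3] at h2
  have h4 : (fun i : ℕ => (if True then ∑' j : ℕ, (X : A) ^ ((i + 1) * j) else 1) * (1 - X ^ (i + 1)))
      = fun _ => 1 := by
    funext i
    simp only [if_true, pow_mul]
    exact tsum_pow_mul_one_sub_of_constantCoeff_eq_zero (by simp)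
  rw [h4] at h2
  exact h2.unique hasProd_one

lemma pow_eleven (f : A) {n : ℕ} (hn : ¬ 11 ∣ n) : coeff n (f ^ 11) = 0 := by
  obtain ⟨m, rfl⟩ : ∃ m, n = m + 1 := ⟨n - 1, by omega⟩
  have h : derivative K (f ^ 11) = 0 := by
    rw [Derivation.leibniz_pow]
    have : (11 : ℕ) • (f ^ (11 - 1) • derivative K f) = ((11 : ℕ) : K) • (f ^ (11 - 1) • derivative K f) := by
      rw [Nat.cast_smul_eq_nsmul]
    rw [this, show ((11 : ℕ) : K) = 0 from rfl, zero_smul]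
  have h2 := congrArg (coeff m) h
  rw [coeff_derivative, map_zero, mul_eq_zero] at h2
  rcases h2 with h2 | h2
  · exact h2
  · exfalso; apply hn
    exact (ZMod.natCast_eq_zero_iff (m + 1) 11).1 (by exact_mod_cast h2)

def T (k : ℤ) : ℕ := (k * (k + 1) / 2).toNat

lemma two_T (k : ℤ) : 2 * (T k : ℤ) = k * (k + 1) := by
  have h0 : 0 ≤ k * (k + 1) := by
    rcases le_or_gt 0 k with h | h
    · positivity
    · nlinarith
  have h1 : k * (k + 1) % 2 = 0 := by
    exact Int.even_iff.1 (Int.even_mul_succ_self k)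
  unfold T
  generalize k * (k + 1) = z at *
  omega

def s (k : ℤ) : ℤ := (k.negOnePow : ℤ)

lemma s_add (a b : ℤ) : s (a + b) = s a * s b := by simp [s, Int.negOnePow_add]
lemma s_neg (a : ℤ) : s (-a) = s a := by simp [s, Int.negOnePow_neg]
lemma s_one : s 1 = -1 := by simp [s]
lemma s_zero : s 0 = 1 := by simp [s]
lemma s_sq (a : ℤ) : s a * s a = 1 := by
  rw [← s_add]; simp [s, Int.negOnePow_even (a + a) ⟨a, rfl⟩]

noncomputable def b : ℕ → ℤ → A
  | 0, k => if k = 0 then 1 else if k = -1 then -1 else 0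
  | n + 1, k => (1 + X ^ (2 * n + 2)) * b n k - X ^ (n + 1) * (b n (k - 1) + b n (k + 1))

lemma b_supp (n : ℕ) : ∀ k : ℤ, (n : ℤ) < k ∨ k < -(n + 1 : ℤ) → b n k = 0 := by
  induction n with
  | zero => intro k hk; simp only [b]; rw [if_neg (by omega), if_neg (by omega)]
  | succ n ih =>
    intro k hk
    simp only [b]
    push_cast at hk
    rw [ih k (by omega), ih (k - 1) (by omega), ih (k + 1) (by omega)]; simp

/-- closed form -/
lemma b_closed (n : ℕ) : ∀ (i j : ℕ) (k : ℤ), i + j = 2 * n + 1 → (i : ℤ) = n - k →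
    b n k * P i * P j = ((s k : ℤ) : A) * X ^ (T k) * P (2 * n + 1) := by
  induction n with
  | zero =>
    intro i j k h1 h2
    have : k = 0 ∨ k = -1 := by omega
    rcases this with rfl | rfl
    · have : i = 0 := by omega
      have : j = 1 := by omega
      subst_vars
      simp [b, s, T, P]
    · have : i = 1 := by omega
      have : j = 0 := by omega
      subst_vars
      simp [b, s, T, P]
  | succ n ih =>
    intro i j k h1 h2
    push_cast at h2
    have hj : (j : ℤ) = n + 2 + k := by omega
    -- middle
    have e0 : b n k * P i * P j = (1 - X ^ i) * (1 - X ^ j) *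
        (((s k : ℤ) : A) * X ^ (T k) * P (2 * n + 1)) := by
      rcases Nat.eq_zero_or_pos i with hi | hi
      · rw [b_supp n k (by omega)]; simp [hi]
      rcases Nat.eq_zero_or_pos j with hj' | hj'
      · rw [b_supp n k (by omega)]; simp [hj']
      obtain ⟨i, rfl⟩ : ∃ i', i = i' + 1 := ⟨i - 1, by omega⟩
      obtain ⟨j, rfl⟩ : ∃ i', j = i' + 1 := ⟨j - 1, by omega⟩
      rw [← ih i j k (by omega) (by omega), P_succ, P_succ]; ring
    -- k + 1
    have e1 : b n (k + 1) * P i * P j = (1 - X ^ i) * (1 - X ^ (i - 1)) *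
        (((s (k + 1) : ℤ) : A) * X ^ (T (k + 1)) * P (2 * n + 1)) := by
      rcases Nat.lt_or_ge i 2 with hi | hi
      · rw [b_supp n (k + 1) (by omega)]
        interval_cases i <;> simp
      obtain ⟨i, rfl⟩ : ∃ i', i = i' + 2 := ⟨i - 2, by omega⟩
      rw [← ih i j (k + 1) (by omega) (by omega), P_succ, P_succ,
        show i + 2 - 1 = i + 1 by omega]; ring
    have e2 : b n (k - 1) * P i * P j = (1 - X ^ j) * (1 - X ^ (j - 1)) *
        (((s (k - 1) : ℤ) : A) * X ^ (T (k - 1)) * P (2 * n + 1)) := by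
      rcases Nat.lt_or_ge j 2 with hi | hi
      · rw [b_supp n (k - 1) (by omega)]
        interval_cases j <;> simp
      obtain ⟨j, rfl⟩ : ∃ i', j = i' + 2 := ⟨j - 2, by omega⟩
      rw [← ih i j (k - 1) (by omega) (by omega), P_succ, P_succ,
        show j + 2 - 1 = j + 1 by omega]; ring
    have s1 : s (k + 1) = - s k := by rw [s_add, s_one]; ring
    have s2 : s (k - 1) = - s k := by rw [sub_eq_add_neg, s_add, s_neg, s_one]; ring
    have t0 := two_T k
    have t1 : (X : A) ^ (n + 1) * X ^ (T (k + 1)) = X ^ j * X ^ (T k) := by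
      rw [← pow_add, ← pow_add]; congr 1
      have := two_T (k + 1)
      zify
      have : 2 * ((n : ℤ) + 1 + T (k + 1)) = 2 * (j + T k) := by
        linear_combination this - t0 - 2 * hj
      omega
    have t2 : (X : A) ^ (n + 1) * X ^ (T (k - 1)) = X ^ i * X ^ (T k) := by
      rw [← pow_add, ← pow_add]; congr 1
      have := two_T (k - 1)
      zify
      have : 2 * ((n : ℤ) + 1 + T (k - 1)) = 2 * (i + T k) := by
        linear_combination this - t0 - 2 * h2
      omega
    rw [s1] at e1
    rw [s2] at e2
    push_cast at e1 e2
    have key : (1 + (X : A) ^ (2 * n + 2)) * ((1 - X ^ i) * (1 - X ^ j))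
        + X ^ j * ((1 - X ^ i) * (1 - X ^ (i - 1))) + X ^ i * ((1 - X ^ j) * (1 - X ^ (j - 1)))
        = (1 - X ^ (2 * n + 2)) * (1 - X ^ (2 * n + 3)) := by
      have x1 : (X : A) ^ (2 * n + 3) = X ^ i * X ^ j := by rw [← pow_add]; congr 1; omega
      rcases Nat.eq_zero_or_pos i with hi | hi
      · subst hi
        have : (X : A) ^ (2 * n + 2) = X ^ (j - 1) := by congr 1; omega
        rw [x1, this]; simp; ring
      rcases Nat.eq_zero_or_pos j with hj' | hj'
      · subst hj'
        have : (X : A) ^ (2 * n + 2) = X ^ (i - 1) := by congr 1; omega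
        rw [x1, this]; simp; ring
      have x2 : (X : A) ^ (2 * n + 2) = X ^ i * X ^ (j - 1) := by rw [← pow_add]; congr 1; omega
      have x3 : (X : A) ^ (2 * n + 2) = X ^ j * X ^ (i - 1) := by rw [← pow_add]; congr 1; omega
      rw [x1]
      linear_combination (1 - X ^ j) * x2 + (1 - X ^ i) * x3
    have hP : P (2 * (n + 1) + 1) = P (2 * n + 1) * (1 - X ^ (2 * n + 2)) * (1 - X ^ (2 * n + 3)) := by
      rw [show 2 * (n + 1) + 1 = 2 * n + 1 + 1 + 1 by ring, P_succ, P_succ]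
    rw [hP]
    simp only [b]
    linear_combination (1 + (X : A) ^ (2 * n + 2)) * e0 - X ^ (n + 1) * e1 - X ^ (n + 1) * e2
      + ((s k : ℤ) : A) * X ^ (T k) * P (2 * n + 1) * key
      + (1 - X ^ i) * (1 - X ^ (i - 1)) * ((s k : ℤ) : A) * P (2 * n + 1) * t1
      + (1 - X ^ j) * (1 - X ^ (j - 1)) * ((s k : ℤ) : A) * P (2 * n + 1) * t2

lemma b_hasSum (n : ℕ) : HasSum (b n) 0 ∧ HasSum (fun k : ℤ => (k : A) * b n k) (P n ^ 2) := by
  induction n with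
  | zero =>
    constructor
    · have := hasSum_sum_of_ne_finset_zero (f := b 0) (s := {0, -1}) (L := SummationFilter.unconditional ℤ) (by
        intro k hk; simp at hk; simp [b, hk])
      simpa [b] using this
    · have := hasSum_sum_of_ne_finset_zero (f := fun k : ℤ => (k : A) * b 0 k) (s := {0, -1}) (L := SummationFilter.unconditional ℤ) (by
        intro k hk; simp at hk; simp [b, hk])
      simpa [b, P] using this
  | succ n ih =>
    obtain ⟨h0, h1⟩ := ih
    have p0 : HasSum (fun k : ℤ => b n (k - 1)) 0 := (Equiv.subRight (1 : ℤ)).hasSum_iff.2 h0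
    have m0 : HasSum (fun k : ℤ => b n (k + 1)) 0 := (Equiv.addRight (1 : ℤ)).hasSum_iff.2 h0
    have p1 : HasSum (fun k : ℤ => (k : A) * b n (k - 1)) (P n ^ 2) := by
      have := ((Equiv.subRight (1 : ℤ)).hasSum_iff.2 h1).add p0
      rw [add_zero] at this
      refine hs_congr this (fun k => ?_) rfl
      simp; ring
    have m1 : HasSum (fun k : ℤ => (k : A) * b n (k + 1)) (P n ^ 2) := by
      have := ((Equiv.addRight (1 : ℤ)).hasSum_iff.2 h1).sub m0
      rw [sub_zero] at this
      refine hs_congr this (fun k => ?_) rfl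
      simp; ring
    constructor
    · have := (h0.mul_left (1 + X ^ (2 * n + 2))).sub ((p0.add m0).mul_left (X ^ (n + 1)))
      simpa [b] using this
    · have := (h1.mul_left (1 + X ^ (2 * n + 2))).sub ((p1.add m1).mul_left (X ^ (n + 1)))
      refine hs_congr this (fun k => ?_) ?_
      · simp only [b]; ring
      · rw [P_succ]; ring

lemma T_bound (k : ℤ) : k ≤ T k ∧ -k - 1 ≤ T k := by
  have := two_T k
  constructor
  · rcases le_or_gt k 0 with h | h
    · omega
    · nlinarith
  · rcases le_or_gt 0 (k + 1) with h | h
    · omega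
    · nlinarith

lemma b_dvd (n N : ℕ) (hn : 2 * N + 2 ≤ n) (k : ℤ) :
    (X : A) ^ (N + 1) ∣ b n k * E - ((s k : ℤ) : A) * X ^ (T k) := by
  have hb := T_bound k
  rcases Nat.lt_or_ge N (T k) with h | h
  · have hx : (X : A) ^ (N + 1) ∣ X ^ (T k) := pow_dvd_pow _ (by omega)
    refine dvd_sub (Dvd.dvd.mul_right ?_ _) (Dvd.dvd.mul_left hx _)
    by_cases hk : (n : ℤ) < k ∨ k < -(n + 1 : ℤ)
    · rw [b_supp n k hk]; simp
    · have := b_closed n (n - k).toNat (n + 1 + k).toNat k (by omega) (by omega)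
      have h2 : (X : A) ^ (N + 1) ∣ b n k * P (n - k).toNat * P (n + 1 + k).toNat := by
        rw [this, mul_assoc]
        exact Dvd.dvd.mul_left (Dvd.dvd.mul_right hx _) _
      rw [(P_unit _).dvd_mul_right, (P_unit _).dvd_mul_right] at h2
      exact h2
  · have := b_closed n (n - k).toNat (n + 1 + k).toNat k (by omega) (by omega)
    obtain ⟨u, hu⟩ := E_dvd' (N := N) (m := (n - k).toNat) (by omega)
    obtain ⟨v, hv⟩ := E_dvd' (N := N) (m := (n + 1 + k).toNat) (by omega)
    obtain ⟨w, hw⟩ := E_dvd' (N := N) (m := 2 * n + 1) (by omega)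
    rw [← E_unit.dvd_mul_right]
    generalize P (n - k).toNat = Pi at *
    generalize P (n + 1 + k).toNat = Pj at *
    refine ⟨b n k * (u * E + Pi * v) - ((s k : ℤ) : A) * X ^ (T k) * w, ?_⟩
    linear_combination this + b n k * E * hu + b n k * Pi * hv - ((s k : ℤ) : A) * X ^ (T k) * hw

theorem jacobi : HasSum (fun k : ℤ => ((s k * k : ℤ) : A) * X ^ (T k)) (E ^ 3) := by
  rw [hasSum_iff_hasSum_coeff]
  intro N
  have h := ((b_hasSum (2 * N + 2)).2.mul_left E)
  rw [hasSum_iff_hasSum_coeff] at h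
  convert h N using 1
  · funext k
    obtain ⟨c, hc⟩ := b_dvd (2 * N + 2) N le_rfl k
    rw [← sub_eq_zero, ← map_sub]
    refine (X_pow_dvd_iff (n := N + 1)).1 ?_ N (by omega)
    refine ⟨-k * c, ?_⟩
    push_cast
    linear_combination -k * hc
  · rw [← sub_eq_zero, ← map_sub]
    refine (X_pow_dvd_iff (n := N + 1)).1 ?_ N (by omega)
    obtain ⟨u, hu⟩ := E_dvd' (N := N) (m := 2 * N + 2) (by omega)
    refine ⟨E * u * (E + P (2 * N + 2)), ?_⟩
    linear_combination E * (E + P (2 * N + 2)) * hu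

lemma summable_fam {ι : Type} (c : ι → ℤ) (e : ι → ℕ) (h : ∀ N, {i | e i = N}.Finite) :
    Summable (fun i => ((c i : ℤ) : A) * X ^ (e i)) := by
  rw [summable_iff_summable_coeff]
  intro N
  apply summable_of_hasFiniteSupport
  refine (h N).subset ?_
  intro i hi
  by_contra hne
  apply hi
  have : ((c i : ℤ) : A) = C ((c i : ℤ) : K) := by simp
  simp only [this, coeff_C_mul, coeff_X_pow]
  rw [if_neg (fun h => hne h.symm), mul_zero]

lemma T_fin (N : ℕ) : {k : ℤ | T k ≤ N}.Finite := by
  refine (Set.finite_Icc (-(N : ℤ) - 1) N).subset ?_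
  intro k hk
  have := T_bound k
  simp only [Set.mem_ofPred_eq] at hk
  simp only [Set.mem_Icc]; omega

noncomputable def th (e : ℕ) (k : ℤ) : A := ((s k * k ^ e : ℤ) : A) * X ^ (T k)

lemma th_summable (e : ℕ) : Summable (th e) := by
  apply summable_fam
  intro N
  exact (T_fin N).subset (fun k hk => le_of_eq hk)

noncomputable def J (e : ℕ) : A := ∑' k, th e k

lemma th_hasSum (e : ℕ) : HasSum (th e) (J e) := (th_summable e).hasSum

lemma J_one : J 1 = E ^ 3 := by
  apply (th_hasSum 1).unique
  refine hs_congr jacobi (fun k => ?_) rfl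
  simp [th]

lemma eq_zero_of_eq_neg {a : A} (h : a = -a) : a = 0 := by
  have h2 : (C (2 : K)) * a = 0 := by
    have : (C (2 : K) : A) = 2 := map_ofNat _ 2
    rw [this]; linear_combination h
  have h3 : (C (6 : K) : A) * (C (2 : K) * a) = a := by
    rw [← mul_assoc, ← map_mul, show (6 : K) * 2 = 1 from rfl]; simp
  rw [← h3, h2, mul_zero]

lemma J_zero : J 0 = 0 := by
  have h1 := th_hasSum 0
  have h2 := (Equiv.subLeft (-1 : ℤ)).hasSum_iff.2 h1
  apply eq_zero_of_eq_neg
  apply h1.unique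
  refine hs_congr h2.neg (fun k => ?_) rfl
  have t : T (-1 - k) = T k := by
    have := two_T (-1 - k)
    have := two_T k
    have : 2 * (T (-1 - k) : ℤ) = 2 * T k := by rw [two_T, two_T]; ring
    omega
  have : s (-1 - k) = - s k := by rw [sub_eq_add_neg, s_add, s_neg, s_neg, s_one]; ring
  simp [th, t, this]

lemma triple (e f g : ℕ) : HasSum (fun x : (ℤ × ℤ) × ℤ => th e x.1.1 * th f x.1.2 * th g x.2)
    (J e * J f * J g) := by
  have s2 : Summable (fun x : ℤ × ℤ => th e x.1 * th f x.2) := by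
    have := summable_fam (fun x : ℤ × ℤ => s x.1 * x.1 ^ e * (s x.2 * x.2 ^ f))
      (fun x => T x.1 + T x.2) (by
        intro N
        refine ((T_fin N).prod (T_fin N)).subset ?_
        rintro ⟨x, y⟩ h
        simp only [Set.mem_ofPred_eq] at h
        simp only [Set.mem_prod, Set.mem_ofPred_eq]
        omega)
    refine this.congr (fun x => ?_)
    simp only [th]; push_cast; ring
  have h2 := (th_hasSum e).mul (th_hasSum f) s2
  refine h2.mul (th_hasSum g) ?_
  have := summable_fam (fun x : (ℤ × ℤ) × ℤ => s x.1.1 * x.1.1 ^ e * (s x.1.2 * x.1.2 ^ f) * (s x.2 * x.2 ^ g))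
      (fun x => T x.1.1 + T x.1.2 + T x.2) (by
        intro N
        refine (((T_fin N).prod (T_fin N)).prod (T_fin N)).subset ?_
        rintro ⟨⟨x, y⟩, z⟩ h
        simp only [Set.mem_ofPred_eq] at h
        simp only [Set.mem_prod, Set.mem_ofPred_eq]
        omega)
  refine this.congr (fun x => ?_)
  simp only [th]; push_cast; ring

def shear : (ℤ × ℤ) × ℤ ≃ (ℤ × ℤ) × ℤ where
  toFun x := ((x.1.1 + x.2, x.1.2 + x.2), x.2)
  invFun x := ((x.1.1 - x.2, x.1.2 - x.2), x.2)
  left_inv x := by simp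
  right_inv x := by simp

lemma nine : HasSum (fun x : (ℤ × ℤ) × ℤ =>
    ((s (x.1.1 + x.1.2 + x.2) * (x.1.1 ^ 2 * x.1.2) : ℤ) : A) *
      X ^ (T (x.1.1 + x.2) + T (x.1.2 + x.2) + T x.2)) (-2 * E ^ 9) := by
  have h := (((((triple 2 1 0).sub (triple 2 0 1)).sub ((triple 1 1 1).mul_left 2)).add
    ((triple 1 0 2).mul_left 2)).add (triple 0 1 2)).sub (triple 0 0 3)
  have h2 := shear.hasSum_iff.2 h
  refine hs_congr h2 (fun x => ?_) ?_
  · obtain ⟨⟨l, m⟩, k⟩ := x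
    have hs : s (l + m + k) = s (l + k) * s (m + k) * s k := by
      rw [s_add, s_add, s_add, s_add]
      linear_combination -s l * s m * s k * s_sq k
    simp only [shear, Function.comp, Equiv.coe_fn_mk, th, hs]
    push_cast
    ring
  · simp only [J_zero, J_one]; ring

def ex (l m : ℤ) : ℕ := ((l ^ 2 - l * m + m ^ 2 - 1) / 3).toNat

lemma three_ex (l m : ℤ) (h : ¬ 3 ∣ l + m) : 3 * (ex l m : ℤ) + 1 = l ^ 2 - l * m + m ^ 2 := by
  have h1 : 3 ∣ l ^ 2 - l * m + m ^ 2 - 1 := by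
    have : l ^ 2 - l * m + m ^ 2 - 1 = (l + m - 1) * (l + m + 1) - 3 * (l * m) := by ring
    rw [this]
    refine dvd_sub ?_ (Dvd.intro _ rfl)
    have : 3 ∣ l + m - 1 ∨ 3 ∣ l + m + 1 := by omega
    rcases this with h | h
    · exact Dvd.dvd.mul_right h _
    · exact Dvd.dvd.mul_left h _
  have h2 : 0 ≤ l ^ 2 - l * m + m ^ 2 := by nlinarith [sq_nonneg (l - m), sq_nonneg l, sq_nonneg m]
  unfold ex
  generalize l ^ 2 - l * m + m ^ 2 = z at *
  omega

lemma pent_hasSum : HasSum (fun k : ℤ => ((s k : ℤ) : A) * X ^ pentagonal k) E :=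
  hasSum_pentagonalSeries K

lemma fiber (l m : ℤ) : ∃ c : ℤ, (3 ∣ l + m → c = 0) ∧ HasSum (fun k : ℤ =>
    ((s (l + m + k) * (l ^ 2 * m) : ℤ) : A) * X ^ (T (l + k) + T (m + k) + T k))
    (E * (((c * (l ^ 2 * m) : ℤ) : A) * X ^ (ex l m))) := by
  have hr : 3 ∣ l + m ∨ (∃ t, l + m = 3 * t + 1) ∨ (∃ t, l + m = 3 * t + 2) := by
    have : 3 ∣ l + m ∨ l + m = 3 * ((l + m) / 3) + 1 ∨ l + m = 3 * ((l + m) / 3) + 2 := by omega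
    rcases this with h | h | h
    · exact Or.inl h
    · exact Or.inr (Or.inl ⟨_, h⟩)
    · exact Or.inr (Or.inr ⟨_, h⟩)
  rcases hr with h | ⟨t, h⟩ | ⟨t, h⟩
  · refine ⟨0, fun _ => rfl, ?_⟩
    obtain ⟨t, h⟩ := h
    have h1 : Summable (fun k : ℤ =>
      ((s (l + m + k) * (l ^ 2 * m) : ℤ) : A) * X ^ (T (l + k) + T (m + k) + T k)) := by
      apply summable_fam
      intro N
      refine (T_fin N).subset ?_
      intro k hk
      simp only [Set.mem_ofPred_eq] at *
      omega
    obtain ⟨a, ha⟩ := h1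
    have h2 := (Equiv.subLeft (-1 - 2 * t : ℤ)).hasSum_iff.2 ha
    have : a = 0 := by
      apply eq_zero_of_eq_neg
      apply ha.unique
      refine hs_congr h2.neg (fun k => ?_) rfl
      have e1 : s (l + m + (-1 - 2 * t - k)) = - s (l + m + k) := by
        rw [s_add (l + m), s_add (l + m), show -1 - 2 * t - k = -(1 + (t + t) + k) by ring, s_neg,
          s_add _ k, s_add 1, s_add t, s_one, s_sq]
        ring
      have e2 : T (l + (-1 - 2 * t - k)) + T (m + (-1 - 2 * t - k)) + T (-1 - 2 * t - k)
          = T (l + k) + T (m + k) + T k := by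
        zify
        have : 2 * (T (l + (-1 - 2 * t - k)) + T (m + (-1 - 2 * t - k)) + T (-1 - 2 * t - k) : ℤ)
          = 2 * (T (l + k) + T (m + k) + T k) := by
          simp only [mul_add, two_T]
          obtain rfl : l = 3 * t - m := by omega
          ring
        omega
      simp only [Function.comp, Equiv.subLeft_apply, e1, e2]
      push_cast; ring
    rw [this] at ha
    simpa using ha
  · refine ⟨s (t + 1) * s (l + m), fun h' => by omega, ?_⟩
    have h1 := ((Equiv.addRight (t + 1 : ℤ)).hasSum_iff.2 pent_hasSum).mul_right
      (((s (t + 1) * s (l + m) * (l ^ 2 * m) : ℤ) : A) * X ^ (ex l m))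
    refine hs_congr h1 (fun k => ?_) rfl
    have e2 : T (l + k) + T (m + k) + T k = pentagonal (k + (t + 1)) + ex l m := by
      have h3 := three_ex l m (by omega)
      have h4 := two_mul_natCast_pentagonal (k + (t + 1))
      have : 6 * (T (l + k) + T (m + k) + T k : ℤ) = 6 * (pentagonal (k + (t + 1)) + ex l m) := by
        obtain rfl : l = 3 * t + 1 - m := by omega
        linear_combination 3 * two_T (3 * t + 1 - m + k) + 3 * two_T (m + k) + 3 * two_T k - 3 * h4 - 2 * h3
      omega
    simp only [Function.comp, Equiv.coe_addRight, e2, pow_add]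
    have e1 : s (l + m + k) = s (k + (t + 1)) * (s (t + 1) * s (l + m)) := by
      rw [s_add (l + m) k, s_add k (t + 1)]
      linear_combination -s (l + m) * s k * s_sq (t + 1)
    rw [e1]; push_cast; ring
  · refine ⟨s (t + 1) * s (l + m), fun h' => by omega, ?_⟩
    have h1 := ((Equiv.subLeft (-(t + 1) : ℤ)).hasSum_iff.2 pent_hasSum).mul_right
      (((s (t + 1) * s (l + m) * (l ^ 2 * m) : ℤ) : A) * X ^ (ex l m))
    refine hs_congr h1 (fun k => ?_) rfl
    have e2 : T (l + k) + T (m + k) + T k = pentagonal (-(t + 1) - k) + ex l m := by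
      have h3 := three_ex l m (by omega)
      have h4 := two_mul_natCast_pentagonal (-(t + 1) - k)
      have : 6 * (T (l + k) + T (m + k) + T k : ℤ) = 6 * (pentagonal (-(t + 1) - k) + ex l m) := by
        obtain rfl : l = 3 * t + 2 - m := by omega
        linear_combination 3 * two_T (3 * t + 2 - m + k) + 3 * two_T (m + k) + 3 * two_T k - 3 * h4 - 2 * h3
      omega
    simp only [Function.comp, Equiv.subLeft_apply, e2, pow_add]
    have e1 : s (l + m + k) = s (-(t + 1) - k) * (s (t + 1) * s (l + m)) := by
      rw [show -(t + 1) - k = -(k + (t + 1)) by ring, s_neg, s_add (l + m) k, s_add k (t + 1)]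
      linear_combination -s (l + m) * s k * s_sq (t + 1)
    rw [e1]; push_cast; ring

lemma inert : ∀ l m : K, l ^ 2 - l * m + m ^ 2 = 0 → m = 0 := by decide

lemma eight (N : ℕ) (hN : N % 11 = 7) : coeff N (E ^ 8) = 0 := by
  choose c hc0 hc using fiber
  have h := nine.prod_fiberwise (g := fun x : ℤ × ℤ =>
    E * (((c x.1 x.2 * (x.1 ^ 2 * x.2) : ℤ) : A) * X ^ (ex x.1 x.2))) (fun x => hc x.1 x.2)
  have h2 := h.mul_left p
  have h3 : p * (-2 * E ^ 9) = -(E ^ 8 + E ^ 8) := by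
    linear_combination (-2 * E ^ 8) * p_mul_E
  rw [h3] at h2
  rw [hasSum_iff_hasSum_coeff] at h2
  have h4 := h2 N
  have h5 : (fun x : ℤ × ℤ => coeff N (p * (E * (((c x.1 x.2 * (x.1 ^ 2 * x.2) : ℤ) : A) * X ^ (ex x.1 x.2)))))
      = fun _ => 0 := by
    funext ⟨l, m⟩
    rw [← mul_assoc, p_mul_E, one_mul]
    have : ((c l m * (l ^ 2 * m) : ℤ) : A) = C ((c l m * (l ^ 2 * m) : ℤ) : K) := by simp
    simp only [this, coeff_C_mul, coeff_X_pow]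
    by_cases hd : 3 ∣ l + m
    · simp [hc0 l m hd]
    split_ifs with he
    · have h6 := three_ex l m hd
      rw [← he] at h6
      have h7 : (l : K) ^ 2 - l * m + m ^ 2 = 0 := by
        have : ((l ^ 2 - l * m + m ^ 2 : ℤ) : K) = 0 := by
          rw [ZMod.intCast_zmod_eq_zero_iff_dvd] 
          rw [← h6]; push_cast; omega
        simpa using this
      have := inert _ _ h7
      push_cast
      rw [this]; ring
    · simp
  rw [h5] at h4
  have h6 := h4.unique hasSum_zero
  rw [map_neg, map_add] at h6
  generalize coeff N (E ^ 8) = z at h6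
  revert z; decide

lemma p_cube (N : ℕ) (hN : N % 11 = 7) : coeff N (p ^ 3) = 0 := by
  have : p ^ 3 = p ^ 11 * E ^ 8 := by
    have : p ^ 11 * E ^ 8 = p ^ 3 * (p * E) ^ 8 := by ring
    rw [this, p_mul_E]; ring
  rw [this, coeff_mul]
  apply Finset.sum_eq_zero
  rintro ⟨i, j⟩ hij
  rw [Finset.HasAntidiagonal.mem_antidiagonal] at hij
  simp only at hij ⊢
  by_cases h : 11 ∣ i
  · rw [eight j (by omega), mul_zero]
  · rw [pow_eleven p h, zero_mul]

lemma multipartition_cast (n : ℕ) : (multipartition 3 n : K) = coeff n (p ^ 3) := by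
  have h : p ^ 3 = ∏ i : Fin 3, p := by simp
  rw [h, coeff_prod]
  unfold multipartition
  push_cast
  refine Finset.sum_bij' (fun c _ => Finsupp.equivFunOnFinite.symm c) (fun c _ => ⇑c) ?_ ?_ ?_ ?_ ?_
  · intro c hc
    rw [Finset.Nat.mem_antidiagonalTuple] at hc
    simp [Finset.mem_finsuppAntidiag, hc]
  · intro c hc
    rw [Finset.mem_finsuppAntidiag] at hc
    rw [Finset.Nat.mem_antidiagonalTuple]
    simpa using hc.1
  · intro c hc; rfl
  · intro c hc; ext; rfl
  · intro c hc
    simp [p]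

end MP

theorem multipartition_three_eleven (n : ℕ) : 11 ∣ multipartition 3 (11 * n + 7) := by
  rw [← ZMod.natCast_eq_zero_iff, MP.multipartition_cast]
  exact MP.p_cube _ (by omega)
end
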